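/- arXiv:2512.20979 — 14 statements merged into one kernel-verified Lean document; each statement's English description precedes it below -/
import Mathlib

section
/- Let S be a nonempty right-cancellative semigroup (for all a, b, c in S, ac = bc implies a = b) and let ω be a weight on S, i.e. a function ω : S → ℝ with ω(s) > 0 and ω(st) ≤ ω(s)ω(t) for all s, t ∈ S. Define recursively ω̃₀ = ω and ω̃ₖ(s) = sup { ω̃ₖ₋₁(st)/ω̃ₖ₋₁(t) : t ∈ S } for k ≥ 1. Then for every k ≥ 1 the supremum defining ω̃ₖ(s) is finite for each s ∈ S, and ω̃ₖ is again a weight on S: ω̃ₖ(s) > 0 and ω̃ₖ(st) ≤ ω̃ₖ(s)ω̃ₖ(t) for all s, t ∈ S. -/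
/-- The ratios `ω (s * t) / ω t` of a weight `ω` are bounded above by `ω s`. -/
theorem bddAbove_weight_ratio {S : Type*} [Semigroup S] {ω : S → ℝ} (hpos : ∀ s, 0 < ω s)
    (hsub : ∀ s t, ω (s * t) ≤ ω s * ω t) (s : S) :
    BddAbove {r : ℝ | ∃ t : S, r = ω (s * t) / ω t} := by
  refine ⟨ω s, ?_⟩
  rintro _ ⟨t, rfl⟩
  exact (div_le_iff₀ (hpos t)).2 (hsub s t)

theorem sSup_weight_ratio_pos {S : Type*} [Semigroup S] [Nonempty S] {ω : S → ℝ}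
    (hpos : ∀ s, 0 < ω s) (hsub : ∀ s t, ω (s * t) ≤ ω s * ω t) (s : S) :
    0 < sSup {r : ℝ | ∃ t : S, r = ω (s * t) / ω t} := by
  obtain ⟨t⟩ := ‹Nonempty S›
  exact (div_pos (hpos (s * t)) (hpos t)).trans_le
    (le_csSup (bddAbove_weight_ratio hpos hsub s) ⟨t, rfl⟩)

theorem sSup_weight_ratio_mul_le {S : Type*} [Semigroup S] [Nonempty S] {ω : S → ℝ}
    (hpos : ∀ s, 0 < ω s) (hsub : ∀ s t, ω (s * t) ≤ ω s * ω t) (s t : S) :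
    sSup {r : ℝ | ∃ u : S, r = ω (s * t * u) / ω u} ≤
      sSup {r : ℝ | ∃ u : S, r = ω (s * u) / ω u} *
        sSup {r : ℝ | ∃ u : S, r = ω (t * u) / ω u} := by
  refine csSup_le ⟨_, Classical.arbitrary S, rfl⟩ ?_
  rintro _ ⟨u, rfl⟩
  rw [mul_assoc, ← div_mul_div_cancel₀ (hpos (t * u)).ne']
  exact mul_le_mul (le_csSup (bddAbove_weight_ratio hpos hsub s) ⟨t * u, rfl⟩)
    (le_csSup (bddAbove_weight_ratio hpos hsub t) ⟨u, rfl⟩)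
    (div_pos (hpos _) (hpos _)).le (sSup_weight_ratio_pos hpos hsub s).le

/-- For a nonempty right-cancellative semigroup `S` with a weight `ω`, the recursively
defined functions `ω̃ₖ` (with `ω̃₀ = ω` and `ω̃ₖ(s) = sup {ω̃ₖ₋₁(st)/ω̃ₖ₋₁(t) : t ∈ S}`)
have finite defining suprema and are again weights on `S`. -/
theorem stmt_0 {S : Type*} [Semigroup S] [Nonempty S]
    (hcancel : ∀ a b c : S, a * c = b * c → a = b)
    (ω : S → ℝ) (hω_pos : ∀ s, 0 < ω s)
    (hω_sub : ∀ s t, ω (s * t) ≤ ω s * ω t)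
    (W : ℕ → S → ℝ) (hW0 : W 0 = ω)
    (hWsucc : ∀ (k : ℕ) (s : S),
      W (k + 1) s = sSup {r : ℝ | ∃ t : S, r = W k (s * t) / W k t}) :
    ∀ k : ℕ, 1 ≤ k →
      (∀ s : S, BddAbove {r : ℝ | ∃ t : S, r = W (k - 1) (s * t) / W (k - 1) t}) ∧
      (∀ s : S, 0 < W k s) ∧
      (∀ s t : S, W k (s * t) ≤ W k s * W k t) := by
  have weight : ∀ k, (∀ s, 0 < W k s) ∧ ∀ s t, W k (s * t) ≤ W k s * W k t := by
    intro k
    induction k with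
    | zero => exact hW0 ▸ ⟨hω_pos, hω_sub⟩
    | succ k ih =>
      simp only [hWsucc]
      exact ⟨sSup_weight_ratio_pos ih.1 ih.2, sSup_weight_ratio_mul_le ih.1 ih.2⟩
  exact fun k _ =>
    ⟨bddAbove_weight_ratio (weight (k - 1)).1 (weight (k - 1)).2, weight k⟩
end

section
/- Let S be a nonempty right-cancellative semigroup and ω a weight on S. With ω̃₀ = ω and ω̃ₖ(s) = sup { ω̃ₖ₋₁(st)/ω̃ₖ₋₁(t) : t ∈ S } for k ≥ 1, one has ω̃ₖ₊₁(s) ≤ ω̃ₖ(s) for every k ≥ 0 and every s ∈ S; in particular ω̃₁ ≤ ω pointwise. -/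
/-- For a weight `f`, the quotients `f (s * t) / f t` are bounded above by `f s`. -/
theorem mem_upperBounds_weight_quotients {S : Type*} [Semigroup S] {f : S → ℝ}
    (hpos : ∀ s, 0 < f s) (hsub : ∀ s t, f (s * t) ≤ f s * f t) (s : S) :
    f s ∈ upperBounds {r : ℝ | ∃ t : S, r = f (s * t) / f t} := by
  rintro r ⟨t, rfl⟩
  exact (div_le_iff₀ (hpos t)).2 (hsub s t)

/-- Each quotient `f (s * t) / f t` of a weight `f` is at most their supremum. -/
theorem weight_quotient_le_sSup {S : Type*} [Semigroup S] {f : S → ℝ}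
    (hpos : ∀ s, 0 < f s) (hsub : ∀ s t, f (s * t) ≤ f s * f t) (s t : S) :
    f (s * t) / f t ≤ sSup {r : ℝ | ∃ t : S, r = f (s * t) / f t} :=
  le_csSup ⟨f s, mem_upperBounds_weight_quotients hpos hsub s⟩ ⟨t, rfl⟩

/-- The supremum of the quotients of a weight is positive. -/
theorem sSup_weight_quotients_pos {S : Type*} [Semigroup S] {f : S → ℝ}
    (hpos : ∀ s, 0 < f s) (hsub : ∀ s t, f (s * t) ≤ f s * f t) (s : S) :
    0 < sSup {r : ℝ | ∃ t : S, r = f (s * t) / f t} :=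
  (div_pos (hpos (s * s)) (hpos s)).trans_le (weight_quotient_le_sSup hpos hsub s s)

/-- The supremum of the quotients of a weight is submultiplicative. -/
theorem sSup_weight_quotients_mul_le {S : Type*} [Semigroup S] {f : S → ℝ}
    (hpos : ∀ s, 0 < f s) (hsub : ∀ s t, f (s * t) ≤ f s * f t) (s t : S) :
    sSup {r : ℝ | ∃ u : S, r = f (s * t * u) / f u} ≤
      sSup {r : ℝ | ∃ u : S, r = f (s * u) / f u} *
        sSup {r : ℝ | ∃ u : S, r = f (t * u) / f u} := by
  refine csSup_le ⟨_, s, rfl⟩ ?_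
  rintro r ⟨u, rfl⟩
  rw [mul_assoc, ← div_mul_div_cancel₀ (hpos (t * u)).ne']
  exact mul_le_mul (weight_quotient_le_sSup hpos hsub s (t * u))
    (weight_quotient_le_sSup hpos hsub t u) (div_pos (hpos _) (hpos _)).le
    (sSup_weight_quotients_pos hpos hsub s).le


/-- For a nonempty right-cancellative semigroup `S` with a weight `ω`, the recursively
defined weights `ω̃ₖ` satisfy `ω̃ₖ₊₁ ≤ ω̃ₖ` pointwise; in particular `ω̃₁ ≤ ω`. -/
theorem stmt_1 {S : Type*} [Semigroup S] [Nonempty S]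
    (hcancel : ∀ a b c : S, a * c = b * c → a = b)
    (ω : S → ℝ) (hω_pos : ∀ s, 0 < ω s)
    (hω_sub : ∀ s t, ω (s * t) ≤ ω s * ω t)
    (W : ℕ → S → ℝ) (hW0 : W 0 = ω)
    (hWsucc : ∀ (k : ℕ) (s : S),
      W (k + 1) s = sSup {r : ℝ | ∃ t : S, r = W k (s * t) / W k t}) :
    (∀ (k : ℕ) (s : S), W (k + 1) s ≤ W k s) ∧ (∀ s : S, W 1 s ≤ ω s) := by
  have hweight : ∀ k, (∀ s, 0 < W k s) ∧ ∀ s t, W k (s * t) ≤ W k s * W k t := by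
    intro k
    induction k with
    | zero => exact hW0 ▸ ⟨hω_pos, hω_sub⟩
    | succ k ih =>
      simp only [hWsucc]
      exact ⟨sSup_weight_quotients_pos ih.1 ih.2, sSup_weight_quotients_mul_le ih.1 ih.2⟩
  have hanti : ∀ (k : ℕ) (s : S), W (k + 1) s ≤ W k s := by
    intro k s
    rw [hWsucc]
    exact csSup_le ⟨_, s, rfl⟩
      (mem_upperBounds_weight_quotients (hweight k).1 (hweight k).2 s)
  exact ⟨hanti, fun s => hW0 ▸ hanti 0 s⟩
end

section
/- Let X be a nonempty set, f : X → X a self-map, and suppose there is a point x₀ ∈ X such that f(x₀) ≠ x₀, the preimage f⁻¹(f⁻¹({x₀})) is an infinite set, and f⁻¹({x}) is a finite set for every x ≠ x₀. Then for every integer n ≥ 2 there is no self-map g : X → X with gⁿ = f (n-fold composition). -/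
/-- If `h` maps `s` into a finite set and the fibers of `g ∘ h` through points of `s` are finite,
then `s` is finite. -/
theorem Set.Finite.of_mapsTo_of_finite_comp_fibers {α β γ : Type*} {h : α → β} {g : β → γ}
    {s : Set α} {t : Set β} (ht : t.Finite) (hst : Set.MapsTo h s t)
    (hfib : ∀ z ∈ s, ((g ∘ h) ⁻¹' {g (h z)}).Finite) : s.Finite := by
  refine Set.Finite.of_finite_fibers h (ht.subset hst.image_subset) ?_
  rintro _ ⟨z, hz, rfl⟩
  refine (hfib z hz).subset ?_
  rintro y ⟨-, hy⟩
  exact congrArg g hy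

/-- If `f : X → X` has a point `x₀` with `f x₀ ≠ x₀`, `f⁻¹(f⁻¹{x₀})` infinite, and all
other fibers finite, then `f` has no iterative `n`-th root for any `n ≥ 2`. -/
theorem stmt_3 {X : Type*} [Nonempty X] (f : X → X) (x₀ : X)
    (h₁ : f x₀ ≠ x₀)
    (h₂ : (f ⁻¹' (f ⁻¹' {x₀})).Infinite)
    (h₃ : ∀ x : X, x ≠ x₀ → (f ⁻¹' {x}).Finite) :
    ∀ n : ℕ, 2 ≤ n → ¬∃ g : X → X, g^[n] = f := by
  rintro n hn ⟨g, hg⟩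
  obtain ⟨m, rfl⟩ := Nat.exists_eq_add_of_le' hn
  have f_eq_left (z : X) : f z = g^[m + 1] (g z) := by rw [← hg, Function.iterate_succ_apply]
  have f_eq_right (z : X) : f z = g (g^[m + 1] z) := by rw [← hg, Function.iterate_succ_apply']
  have f_comm (z : X) : f (g z) = g (f z) := by rw [f_eq_right (g z), ← f_eq_left]
  have g_ne : g x₀ ≠ x₀ := fun h ↦ h₁ (by rw [← hg]; exact Function.iterate_fixed h _)
  have ne_of_mem {z : X} (hz : f (f z) = x₀) : f z ≠ x₀ := fun h ↦ h₁ (by rwa [h] at hz)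
  -- `f` is constant on this set, with value `g x₀ ≠ x₀`.
  have finite_pred : {z | g^[m + 1] z = x₀}.Finite :=
    (h₃ _ g_ne).subset fun z hz ↦ by
      change f z = g x₀
      rw [f_eq_right, show g^[m + 1] z = x₀ from hz]
  have finite_far : {z | f (f z) = x₀ ∧ f (g z) ≠ x₀}.Finite := by
    have finite_image : {w | g^[m + 1] (f w) = x₀ ∧ f w ≠ x₀}.Finite :=
      Set.Finite.of_finite_fibers f
        (finite_pred.subset (by rintro _ ⟨w, hw, rfl⟩; exact hw.1))
        (by rintro _ ⟨w, hw, rfl⟩; exact (h₃ _ hw.2).subset Set.inter_subset_right)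
    have f_comp : g^[m + 1] ∘ g = f := funext fun z ↦ (f_eq_left z).symm
    refine finite_image.of_mapsTo_of_finite_comp_fibers (h := g) (g := g^[m + 1]) ?_ ?_
    · rintro z ⟨hz, hz'⟩
      exact ⟨by rw [f_comm, ← f_eq_left, hz], hz'⟩
    · rintro z ⟨hz, -⟩
      rw [f_comp, ← f_eq_left]
      exact h₃ _ (ne_of_mem hz)
  have finite_near : {z | f (f z) = x₀ ∧ f (g z) = x₀}.Finite := by
    by_cases hper : g^[m + 1] x₀ = x₀
    · have hm : g^[m] x₀ ≠ x₀ := fun h ↦ g_ne (by rwa [Function.iterate_succ_apply', h] at hper)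
      have finite_two : {z | g (g z) = x₀}.Finite :=
        (h₃ _ hm).subset fun z hz ↦ by
          change f z = g^[m] x₀
          rw [← hg, Function.iterate_succ_apply, Function.iterate_succ_apply,
            show g (g z) = x₀ from hz]
      have f_comp : g ∘ g^[m + 1] = f := funext fun z ↦ (f_eq_right z).symm
      refine finite_two.of_mapsTo_of_finite_comp_fibers (h := g^[m + 1]) (g := g) ?_ ?_
      · rintro z ⟨-, hz⟩
        change g (g (g^[m + 1] z)) = x₀
        rw [← f_eq_right, ← f_comm, hz]
      · rintro z ⟨hz, -⟩
        rw [f_comp, ← f_eq_right]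
        exact h₃ _ (ne_of_mem hz)
    · refine Set.finite_empty.subset ?_
      rintro z ⟨hz, hz'⟩
      refine hper ?_
      rw [f_eq_left, ← f_comm, hz'] at hz
      exact hz
  refine h₂ ((finite_far.union finite_near).subset fun z hz ↦ ?_)
  by_cases h : f (g z) = x₀
  exacts [Or.inr ⟨hz, h⟩, Or.inl ⟨hz, h⟩]
end

section
/- Fix integers n ≥ 2 and m ≥ 1, and let Q = [0,1]^m be the unit cube in ℝ^m. The set of continuous self-maps f : Q → Q admitting no self-map g : Q → Q (continuous or not) with gⁿ = f is dense in the space C(Q, Q) of continuous self-maps of Q equipped with the uniform (supremum) metric. -/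
open MvPolynomial in
/-- A polynomial system whose leading forms are the pure powers `δ * x i ^ N` has only finitely
many real solutions. -/
theorem finite_zeros_of_pure_power_leading_forms {m N : ℕ} {δ : ℝ} (hδ : δ ≠ 0)
    (q : Fin m → MvPolynomial (Fin m) ℝ) (hq : ∀ i, (q i).totalDegree < N) :
    {x : Fin m → ℝ | ∀ i, eval x (q i) + δ * x i ^ N = 0}.Finite := by
  set Z := {x : Fin m → ℝ | ∀ i, eval x (q i) + δ * x i ^ N = 0}
  let φ : MvPolynomial (Fin m) ℝ →ₐ[ℝ] (Z → ℝ) := aeval (fun i z => z.1 i)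
  have hφ : ∀ p z, φ p z = eval z.1 p := by
    intro p z
    have h : (Pi.evalAlgHom ℝ (fun _ : Z => ℝ) z).comp φ = aeval z.1 := by
      ext i
      simp [φ]
    have h' := DFunLike.congr_fun h p
    simpa [aeval_eq_eval] using h'
  let B : Set (Fin m →₀ ℕ) := Set.Iic (Finsupp.equivFunOnFinite.symm fun _ => N)
  let W : Submodule ℝ (Z → ℝ) := Submodule.span ℝ ((fun e => φ (monomial e 1)) '' B)
  have hW : ∀ d : ℕ, ∀ p : MvPolynomial (Fin m) ℝ, p.totalDegree < d → φ p ∈ W := by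
    intro d
    induction d with
    | zero => intro p hp; omega
    | succ d ih =>
      intro p hp
      rw [p.as_sum, map_sum]
      refine Submodule.sum_mem _ fun e he => ?_
      have hmon : monomial e (coeff e p) = coeff e p • monomial e (1 : ℝ) := by
        rw [smul_monomial, smul_eq_mul, mul_one]
      rw [hmon, map_smul]
      refine Submodule.smul_mem _ _ ?_
      by_cases heB : e ∈ B
      · exact Submodule.subset_span ⟨e, heB, rfl⟩
      obtain ⟨i, hi⟩ : ∃ i, N < e i := by
        by_contra! h
        exact heB fun i => h i
      have hle : Finsupp.single i N ≤ e := by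
        rw [Finsupp.single_le_iff]
        exact hi.le
      have hsplit : e - Finsupp.single i N + Finsupp.single i N = e := tsub_add_cancel_of_le hle
      have hdeg : (e - Finsupp.single i N).degree + N = e.degree := by
        conv_rhs => rw [← hsplit]
        simp
      have hed : e.degree ≤ p.totalDegree := le_totalDegree he
      have hreduce : φ (monomial e 1) =
          φ ((-δ⁻¹) • (monomial (e - Finsupp.single i N) 1 * q i)) := by
        funext z
        have hz := z.2 i
        have hmul : monomial e (1 : ℝ) =
            monomial (e - Finsupp.single i N) 1 * X i ^ N := by
          rw [X_pow_eq_monomial, monomial_mul, hsplit, one_mul]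
        have hpow : z.1 i ^ N = -δ⁻¹ * eval z.1 (q i) := by
          field_simp
          linarith
        rw [hφ, hφ, hmul, smul_eval, map_mul, map_mul, map_pow, eval_X, hpow]
        ring
      rw [hreduce]
      refine ih _ ((totalDegree_smul_le _ _).trans_lt ((totalDegree_mul _ _).trans_lt ?_))
      have h1 : (monomial (e - Finsupp.single i N) (1 : ℝ)).totalDegree ≤
          (e - Finsupp.single i N).degree := totalDegree_monomial_le _ _
      have h2 := hq i
      omega
  have hFG : (Subalgebra.toSubmodule φ.range).FG := by
    have hWfg : W.FG := Submodule.fg_span ((Set.finite_Iic _).image _)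
    have heq : Subalgebra.toSubmodule φ.range = W := by
      apply le_antisymm
      · rintro _ ⟨p, rfl⟩
        exact hW _ p (Nat.lt_succ_self _)
      · refine Submodule.span_le.2 ?_
        rintro _ ⟨e, -, rfl⟩
        exact ⟨_, rfl⟩
    rwa [heq]
  have hcoord : ∀ i, ∃ S : Set ℝ, S.Finite ∧ ∀ z : Z, z.1 i ∈ S := by
    intro i
    obtain ⟨p, hp, hroot⟩ := IsIntegral.of_mem_of_fg φ.range hFG (φ (X i)) ⟨_, rfl⟩
    refine ⟨{t | p.IsRoot t}, Polynomial.finite_setOfPred_isRoot hp.ne_zero, fun z => ?_⟩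
    have h := congrFun hroot z
    have h' : (Pi.evalAlgHom ℝ (fun _ : Z => ℝ) z) (Polynomial.aeval (φ (X i)) p) = 0 := h
    rw [← Polynomial.aeval_algHom_apply] at h'
    simpa [hφ, Polynomial.IsRoot] using h'
  choose S hS hmem using hcoord
  exact (Set.Finite.pi' hS).subset fun z hz i => hmem i ⟨z, hz⟩

/-- If exactly one fibre of `f` is uncountable, it lies over a non-fixed point `p`, and it meets the
range of `f` in an uncountable set, then `f` has no iterative root. -/
theorem iterate_ne_of_unique_uncountable_fiber {X : Type*} {f : X → X} {p : X} (hp : f p ≠ p)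
    (hfib : ∀ z, z ≠ p → (f ⁻¹' {z}).Countable)
    (hunc : ¬ (f ⁻¹' {p} ∩ Set.range f).Countable) {n : ℕ} (hn : 2 ≤ n) (g : X → X) :
    g^[n] ≠ f := by
  rintro rfl
  obtain ⟨k, rfl⟩ : ∃ k, n = k + 2 := ⟨n - 2, by omega⟩
  have hgp : g p ≠ p := fun h => hp (Function.iterate_fixed h _)
  set f := g^[k + 2] with hf
  have hcomm : ∀ x, f (g x) = g (f x) := fun x => by
    rw [hf, ← Function.iterate_succ_apply, Function.iterate_succ_apply']
  have hfg : ∀ x, f x = g^[k + 1] (g x) := fun x => Function.iterate_succ_apply _ _ _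
  have hgf : ∀ x, f x = g (g^[k + 1] x) := fun x => Function.iterate_succ_apply' _ _ _
  refine hunc ?_
  have hcover : f ⁻¹' {p} ∩ Set.range f ⊆
      ⋃ y ∈ f ⁻¹' {g p}, (f ⁻¹' {p} ∩ Set.range f) ∩ g ⁻¹' {y} := by
    intro x hx
    have hxp : f x = p := hx.1
    refine Set.mem_biUnion (x := g x) ?_ ⟨hx, rfl⟩
    simp [hcomm, hxp]
  refine ((hfib _ hgp).biUnion fun y _ => ?_).mono hcover
  by_cases hy : g^[k] y = p
  · refine Set.countable_empty.mono ?_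
    rintro x ⟨⟨hx, -⟩, hxy⟩
    have hx' : f x = p := hx
    have hxy' : g x = y := hxy
    rw [hfg, hxy', Function.iterate_succ_apply', hy] at hx'
    exact hgp hx'
  · refine ((hfib _ hy).image g).mono ?_
    rintro x ⟨⟨-, w, rfl⟩, hxy⟩
    have hxy' : g (f w) = y := hxy
    refine ⟨g^[k + 1] w, ?_, (hgf w).symm⟩
    change f _ = _
    rw [hfg, ← hgf, Function.iterate_succ_apply, hxy']

/-- In a convex set one can collapse a small ball to its centre `c` by a continuous map that is
injective away from the fibre over `c` and is the identity off the concentric ball of twice the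
radius. -/
theorem exists_continuousMap_collapsing_ball {E : Type*} [NormedAddCommGroup E] [NormedSpace ℝ E]
    {K : Set E} (hK : Convex ℝ K) (c : K) {r : ℝ} (hr : 0 < r) :
    ∃ φ : C(K, K), (∀ x, dist x c ≤ r → φ x = c) ∧ (∀ x, 2 * r ≤ dist x c → φ x = x) ∧
      (∀ x, dist (φ x) x ≤ 2 * r) ∧ Set.InjOn φ (φ ⁻¹' {c}ᶜ) := by
  let s : K → ℝ := fun x => max 0 (min 1 (dist x c / r - 1))
  have hs0 : ∀ x, 0 ≤ s x := fun x => le_max_left _ _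
  have hs1 : ∀ x, s x ≤ 1 := fun x => max_le zero_le_one (min_le_left _ _)
  have hscont : Continuous s := by fun_prop
  have hsmall : ∀ x, dist x c ≤ r → s x = 0 := fun x hx => by
    have : dist x c / r ≤ 1 := (div_le_one hr).2 hx
    exact max_eq_left ((min_le_right _ _).trans (by linarith))
  have hlarge : ∀ x, 2 * r ≤ dist x c → s x = 1 := fun x hx => by
    have : 2 ≤ dist x c / r := (le_div_iff₀ hr).2 hx
    simp only [s]
    rw [min_eq_left (by linarith), max_eq_right zero_le_one]
  have hmono : ∀ x y, dist x c ≤ dist y c → s x ≤ s y := fun x y h => by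
    simp only [s]
    gcongr
  have hmem : ∀ x : K, (c : E) + s x • ((x : E) - c) ∈ K := fun x =>
    hK.add_smul_sub_mem c.2 x.2 ⟨hs0 x, hs1 x⟩
  let φ : C(K, K) := ⟨fun x => ⟨c + s x • ((x : E) - c), hmem x⟩, by fun_prop⟩
  have hφ : ∀ x, (φ x : E) = c + s x • ((x : E) - c) := fun x => rfl
  have hdist : ∀ x : K, ‖(x : E) - c‖ = dist x c := fun x => by rw [Subtype.dist_eq, dist_eq_norm]
  refine ⟨φ, fun x hx => ?_, fun x hx => ?_, fun x => ?_, ?_⟩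
  · ext
    simp [hφ, hsmall x hx]
  · ext
    simp [hφ, hlarge x hx]
  · have hnorm : dist (φ x) x = (1 - s x) * dist x c := by
      rw [Subtype.dist_eq, dist_comm, dist_eq_norm, hφ, ← hdist,
        ← abs_of_nonneg (sub_nonneg.2 (hs1 x)), ← Real.norm_eq_abs, ← norm_smul]
      congr 1
      module
    rw [hnorm]
    rcases le_total (2 * r) (dist x c) with h | h
    · rw [hlarge x h]
      linarith
    · nlinarith [hs0 x, dist_nonneg (x := x) (y := c)]
  · intro x hx y hy hxy
    have hpos : ∀ x, φ x ≠ c → 0 < s x := fun x hx =>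
      (hs0 x).lt_of_ne fun h => hx (by ext; simp [hφ, ← h])
    have hsx := hpos x hx
    have hsy := hpos y hy
    have hvec : s x • ((x : E) - c) = s y • ((y : E) - c) := by
      have h := congrArg Subtype.val hxy
      rw [hφ, hφ] at h
      exact add_left_cancel h
    have hprod : s x * dist x c = s y * dist y c := by
      have h := congrArg norm hvec
      rwa [norm_smul, norm_smul, Real.norm_of_nonneg hsx.le, Real.norm_of_nonneg hsy.le,
        hdist, hdist] at h
    have hd : dist x c = dist y c := by
      rcases lt_trichotomy (dist x c) (dist y c) with h | h | h
      · nlinarith [hmono x y h.le, dist_nonneg (x := x) (y := c)]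
      · exact h
      · nlinarith [hmono y x h.le, dist_nonneg (x := y) (y := c)]
    have hs : s x = s y := le_antisymm (hmono _ _ hd.le) (hmono _ _ hd.ge)
    rw [hs] at hvec
    ext
    exact sub_left_injective (smul_right_injective E hsy.ne' hvec)

/-- Multivariate polynomials are dense in the continuous functions on a compact set. -/
theorem exists_mvPolynomial_near {m : ℕ} {K : Set (Fin m → ℝ)} [CompactSpace K] (f : C(K, ℝ))
    {ε : ℝ} (hε : 0 < ε) :
    ∃ p : MvPolynomial (Fin m) ℝ, ∀ x : K, |MvPolynomial.eval x.1 p - f x| < ε := by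
  let coord : Fin m → C(K, ℝ) := fun i => ⟨fun x => x.1 i, (continuous_apply i).comp continuous_subtype_val⟩
  let φ : MvPolynomial (Fin m) ℝ →ₐ[ℝ] C(K, ℝ) := MvPolynomial.aeval coord
  have hφ : ∀ p x, φ p x = MvPolynomial.eval x.1 p := by
    intro p x
    have h : (ContinuousMap.evalAlgHom ℝ ℝ x).comp φ = MvPolynomial.aeval x.1 := by
      ext i
      simp [φ, coord]
    have h' := DFunLike.congr_fun h p
    simpa [MvPolynomial.aeval_eq_eval] using h'
  have hsep : φ.range.SeparatesPoints := by
    intro x y hxy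
    obtain ⟨i, hi⟩ : ∃ i, x.1 i ≠ y.1 i := by
      by_contra! h
      exact hxy (Subtype.ext (funext h))
    exact ⟨_, ⟨_, ⟨MvPolynomial.X i, rfl⟩, rfl⟩, by simpa [hφ] using hi⟩
  obtain ⟨⟨_, p, rfl⟩, hp⟩ :=
    ContinuousMap.exists_mem_subalgebra_near_continuousMap_of_separatesPoints φ.range hsep f ε hε
  refine ⟨p, fun x => ?_⟩
  have h := (ContinuousMap.norm_coe_le_norm (φ p - f) x).trans_lt hp
  simpa [hφ] using h

/-- Continuous self-maps of the cube with finite fibres and finitely many fixed points are dense. -/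
theorem exists_near_finite_fibers_finite_fixedPoints {m : ℕ}
    (f : C(Set.Icc (0 : Fin m → ℝ) 1, Set.Icc (0 : Fin m → ℝ) 1)) {ε : ℝ} (hε : 0 < ε) :
    ∃ h : C(Set.Icc (0 : Fin m → ℝ) 1, Set.Icc (0 : Fin m → ℝ) 1),
      (∀ x, dist (h x) (f x) ≤ ε) ∧ (∀ z, (h ⁻¹' {z}).Finite) ∧
        (Function.fixedPoints h).Finite := by
  set η := min ε 1
  have hη : 0 < η := lt_min hε one_pos
  have hη1 : η ≤ 1 := min_le_right _ _
  have hf0 : ∀ x i, 0 ≤ (f x).1 i := fun x i => (f x).2.1 i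
  have hf1 : ∀ x i, (f x).1 i ≤ 1 := fun x i => (f x).2.2 i
  have hcoord : ∀ i, Continuous fun x => (f x).1 i := fun i =>
    (continuous_apply i).comp (continuous_subtype_val.comp f.continuous)
  have happrox : ∀ i, ∃ p : MvPolynomial (Fin m) ℝ, ∀ x : Set.Icc (0 : Fin m → ℝ) 1,
      |MvPolynomial.eval x.1 p - ((1 - η) * (f x).1 i + η / 2)| < η / 4 := fun i =>
    exists_mvPolynomial_near
      ⟨_, ((hcoord i).const_mul (1 - η)).add_const (η / 2)⟩ (by positivity)
  choose P hP using happrox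
  let N : ℕ := Finset.univ.sup (fun i => (P i).totalDegree) + 2
  have hN : ∀ i, (P i).totalDegree < N := fun i => by
    have := Finset.le_sup (f := fun i => (P i).totalDegree) (Finset.mem_univ i)
    simp only [N]
    omega
  have hδ : η / 4 ≠ 0 := by positivity
  let H : (Fin m → ℝ) → Fin m → ℝ := fun x i => MvPolynomial.eval x (P i) + η / 4 * x i ^ N
  have hHcont : Continuous H :=
    continuous_pi fun i => ((P i).continuous_eval).add (by fun_prop)
  have hpow : ∀ x : Set.Icc (0 : Fin m → ℝ) 1, ∀ i, 0 ≤ x.1 i ^ N ∧ x.1 i ^ N ≤ 1 := fun x i =>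
    ⟨pow_nonneg (x.2.1 i) _, pow_le_one₀ (x.2.1 i) (x.2.2 i)⟩
  have hHmem : ∀ x : Set.Icc (0 : Fin m → ℝ) 1, H x.1 ∈ Set.Icc (0 : Fin m → ℝ) 1 := by
    intro x
    refine ⟨fun i => ?_, fun i => ?_⟩ <;>
    · have h1 := abs_lt.1 (hP i x)
      have h2 := hpow x i
      have h3 := hf0 x i
      have h4 := hf1 x i
      simp only [H, Pi.zero_apply, Pi.one_apply]
      nlinarith
  refine ⟨⟨fun x => ⟨H x.1, hHmem x⟩, by fun_prop⟩, fun x => ?_, fun z => ?_, ?_⟩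
  · rw [Subtype.dist_eq, dist_pi_le_iff hε.le]
    intro i
    have h1 := abs_lt.1 (hP i x)
    have h2 := hpow x i
    have h3 := hf0 x i
    have h4 := hf1 x i
    have h5 : η ≤ ε := min_le_left _ _
    simp only [ContinuousMap.coe_mk, H, Real.dist_eq]
    rw [abs_le]
    constructor <;> nlinarith
  · refine Set.Finite.of_injOn (f := Subtype.val) ?_ Subtype.val_injective.injOn
      (finite_zeros_of_pure_power_leading_forms (N := N) hδ
        (fun i => P i - MvPolynomial.C (z.1 i)) fun i => ?_)
    · intro x hx i
      have h := congrFun (congrArg Subtype.val hx) i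
      simp only [ContinuousMap.coe_mk, H] at h
      simp only [map_sub, MvPolynomial.eval_C]
      linarith
    · exact (MvPolynomial.totalDegree_sub_C_le _ _).trans_lt (hN i)
  · refine Set.Finite.of_injOn (f := Subtype.val) ?_ Subtype.val_injective.injOn
      (finite_zeros_of_pure_power_leading_forms (N := N) hδ
        (fun i => P i - MvPolynomial.X i) fun i => ?_)
    · intro x hx i
      have h := congrFun (congrArg Subtype.val hx) i
      simp only [ContinuousMap.coe_mk, H] at h
      simp only [map_sub, MvPolynomial.eval_X]
      linarith
    · refine (MvPolynomial.totalDegree_sub _ _).trans_lt (max_lt (hN i) ?_)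
      rw [MvPolynomial.totalDegree_X]
      simp only [N]
      omega

/-- A self-map of an infinite type with finite fibres and finitely many fixed points moves some
point of the range of its second iterate. -/
theorem exists_iterate_two_not_fixed {X : Type*} [Infinite X] {h : X → X}
    (hfib : ∀ z, (h ⁻¹' {z}).Finite) (hfix : (Function.fixedPoints h).Finite) :
    ∃ a, h (h (h a)) ≠ h (h a) := by
  by_contra! hall
  have hpre : ∀ s : Set X, s.Finite → (h ⁻¹' s).Finite := fun s hs =>
    hs.preimage' fun z _ => hfib z
  refine Set.infinite_univ ((hpre _ (hpre _ hfix)).subset fun a _ => ?_)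
  exact hall a

/-- For fixed `n ≥ 2` and `m ≥ 1`, the continuous self-maps of the unit cube
`Q = [0,1]^m ⊆ ℝ^m` admitting no iterative `n`-th root (continuous or not) are dense in
`C(Q, Q)` with the topology of uniform convergence. -/
theorem stmt_4 (n m : ℕ) (hn : 2 ≤ n) (hm : 1 ≤ m) :
    Dense {f : C(↥(Set.Icc (0 : Fin m → ℝ) 1), ↥(Set.Icc (0 : Fin m → ℝ) 1)) |
      ∀ g : ↥(Set.Icc (0 : Fin m → ℝ) 1) → ↥(Set.Icc (0 : Fin m → ℝ) 1), g^[n] ≠ ⇑f} := by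
  have hconv : Convex ℝ (Set.Icc (0 : Fin m → ℝ) 1) := convex_Icc 0 1
  have : Nonempty (Fin m) := ⟨⟨0, hm⟩⟩
  have : PreconnectedSpace (Set.Icc (0 : Fin m → ℝ) 1) :=
    Subtype.preconnectedSpace hconv.isPreconnected
  have : Infinite (Set.Icc (0 : Fin m → ℝ) 1) :=
    (Set.Icc_infinite (zero_lt_one : (0 : Fin m → ℝ) < 1)).to_subtype
  rw [Metric.dense_iff]
  intro f ε hε
  obtain ⟨h, hnear, hfib, hfix⟩ :=
    exists_near_finite_fibers_finite_fixedPoints f (show 0 < ε / 4 by positivity)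
  obtain ⟨a, ha⟩ := exists_iterate_two_not_fixed hfib hfix
  set c := h a with hc
  set p := h c with hp
  have hpc : p ≠ c := fun hpc => ha (congrArg h hpc)
  have hac : a ≠ c := fun hac => hpc (congrArg h hac).symm
  obtain ⟨δ, hδ, hunif⟩ := Metric.uniformContinuous_iff.1
    (CompactSpace.uniformContinuous_of_continuous h.continuous) (ε / 4) (by positivity)
  obtain ⟨r, hr, hrlt⟩ : ∃ r, 0 < r ∧ r < min (δ / 2) (min (dist a c / 2) (dist p c / 2)) := by
    refine exists_between (lt_min (half_pos hδ) (lt_min ?_ ?_))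
    · exact half_pos (dist_pos.2 hac)
    · exact half_pos (dist_pos.2 hpc)
  rw [lt_min_iff, lt_min_iff] at hrlt
  obtain ⟨hrδ, hra, hrp⟩ := hrlt
  obtain ⟨φ, hφball, hφid, hφdist, hφinj⟩ := exists_continuousMap_collapsing_ball hconv c hr
  have hφc : φ c = c := hφball c (by rw [dist_self]; exact hr.le)
  have hφa : φ a = a := hφid a (by linarith)
  have hφp : φ p = p := hφid p (by linarith)
  refine ⟨h.comp φ, ?_, iterate_ne_of_unique_uncountable_fiber (p := p) ?_ ?_ ?_ hn⟩
  · rw [Metric.mem_ball]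
    refine ((ContinuousMap.dist_le (show 0 ≤ ε / 2 by positivity)).2 fun x => ?_).trans_lt
      (half_lt_self hε)
    have h1 : dist (h (φ x)) (h x) < ε / 4 := hunif ((hφdist x).trans_lt (by linarith))
    have h2 := hnear x
    have h3 := dist_triangle (h (φ x)) (h x) (f x)
    rw [ContinuousMap.comp_apply]
    linarith
  · rw [ContinuousMap.comp_apply, hφp]
    exact ha
  · intro z hz
    have hsub : h.comp φ ⁻¹' {z} ⊆ φ ⁻¹' {c}ᶜ := by
      rintro x rfl hxc
      have hxc' : φ x = c := hxc
      exact hz (by rw [ContinuousMap.comp_apply, hxc'])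
    exact (Set.Finite.of_injOn (f := φ) (t := h ⁻¹' {z}) (fun x hx => hx)
      (hφinj.mono hsub) (hfib z)).countable
  · intro hcount
    refine (Cardinal.Real.Icc_countable_iff.not.2 (not_le.2 hr) : ¬ (Set.Icc 0 r).Countable) ?_
    refine (hcount.image fun y => dist y c).mono fun t ht => ?_
    have hcont : Continuous fun x => dist (h (φ x)) c := by fun_prop
    obtain ⟨x, hx⟩ := mem_range_of_exists_le_of_exists_ge (c := t) hcont
      ⟨a, by rw [hφa, ← hc, dist_self]; exact ht.1⟩
      ⟨c, by rw [hφc, ← hp]; linarith [ht.2]⟩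
    refine ⟨h (φ x), ⟨?_, x, rfl⟩, hx⟩
    have hball : φ (h (φ x)) = c := hφball _ (hx.trans_le ht.2)
    simp [hball, hp]
end

section
/- (Bohr's inequality) Let f be holomorphic on the open unit disc 𝔻 = { z ∈ ℂ : |z| < 1 } with power series f(z) = Σ_{k=0}^∞ aₖ zᵏ, and suppose ‖f‖_∞ := sup_{z ∈ 𝔻} |f(z)| is finite. Then for every real r with 0 ≤ r ≤ 1/3, Σ_{k=0}^∞ |aₖ| rᵏ ≤ ‖f‖_∞. -/
open Complex Metric

/-- A rotation of `y` can be aligned with `x`. -/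
lemma exists_norm_eq_one_norm_add_mul (x y : ℂ) :
    ∃ v : ℂ, ‖v‖ = 1 ∧ ‖x + v * y‖ = ‖x‖ + ‖y‖ := by
  refine ⟨exp (((arg x - arg y : ℝ) : ℂ) * I), norm_exp_ofReal_mul_I _, ?_⟩
  have h : x + exp (((arg x - arg y : ℝ) : ℂ) * I) * y
      = ((‖x‖ + ‖y‖ : ℝ) : ℂ) * exp ((arg x : ℝ) * I) := by
    have hy : exp (((arg x - arg y : ℝ) : ℂ) * I) * y = ‖y‖ * exp ((arg x : ℝ) * I) := by
      conv_lhs => rw [← norm_mul_exp_arg_mul_I y]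
      rw [mul_left_comm, norm_mul_exp_arg_mul_I, ← Complex.exp_add]
      congr 2
      push_cast
      ring
    rw [hy, ofReal_add, add_mul, norm_mul_exp_arg_mul_I]
  rw [h, norm_mul, norm_exp_ofReal_mul_I, mul_one, norm_real, Real.norm_of_nonneg (by positivity)]

lemma integral_exp_int_mul_I (m : ℤ) :
    ∫ t in (0 : ℝ)..2 * Real.pi, exp (m * I * t) = if m = 0 then 2 * (Real.pi : ℂ) else 0 := by
  split_ifs with h
  · simp [h]
  · rw [integral_exp_mul_complex (by simp [h])]
    have : exp (m * I * ((2 * Real.pi : ℝ) : ℂ)) = 1 := by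
      rw [Complex.exp_eq_one_iff]
      exact ⟨m, by push_cast; ring⟩
    simp only [this, ofReal_zero, mul_zero, Complex.exp_zero, sub_self, zero_div]

/-- The trigonometric kernel `2 + 2 Re (v̄ e^{ikt})`, written with complex exponentials. -/
noncomputable def bohrKernel (v : ℂ) (k : ℕ) (t : ℝ) : ℂ :=
  2 + starRingEnd ℂ v * exp (k * I * t) + v * exp (-(k * I * t))

lemma continuous_bohrKernel (v : ℂ) (k : ℕ) : Continuous (bohrKernel v k) := by
  unfold bohrKernel
  fun_prop

lemma bohrKernel_eq_norm {v : ℂ} (hv : ‖v‖ = 1) (k : ℕ) (t : ℝ) :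
    bohrKernel v k t = (‖bohrKernel v k t‖ : ℂ) := by
  set w := v * exp (-(k * I * t)) with hw
  have hconj : starRingEnd ℂ v * exp (k * I * t) = starRingEnd ℂ w := by
    simp [hw, ← Complex.exp_conj]
  have hwn : ‖w‖ = 1 := by
    have : -(k * I * t) = ((-(k * t) : ℝ) : ℂ) * I := by push_cast; ring
    rw [hw, norm_mul, hv, this, norm_exp_ofReal_mul_I, one_mul]
  have hre : -1 ≤ w.re := by
    have := (abs_le.mp (abs_re_le_norm w)).1
    rwa [hwn] at this
  have hK : bohrKernel v k t = ((2 + 2 * w.re : ℝ) : ℂ) := by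
    rw [bohrKernel, hconj, ← hw, add_assoc, add_comm (starRingEnd ℂ w), add_conj]
    push_cast
    ring
  rw [hK, norm_real, Real.norm_of_nonneg (by linarith)]

lemma integral_exp_mul_bohrKernel (v : ℂ) {k : ℕ} (hk : k ≠ 0) (n : ℕ) :
    ∫ t in (0 : ℝ)..2 * Real.pi, exp (n * I * t) * bohrKernel v k t
      = 2 * Real.pi * ((if n = 0 then 2 else 0) + if n = k then v else 0) := by
  have h : ∀ t : ℝ, exp (n * I * t) * bohrKernel v k t
      = 2 * exp ((n : ℤ) * I * t) + starRingEnd ℂ v * exp ((n + k : ℤ) * I * t)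
        + v * exp ((n - k : ℤ) * I * t) := by
    intro t
    have h1 : exp (((n + k : ℤ) : ℂ) * I * t) = exp (n * I * t) * exp (k * I * t) := by
      rw [← Complex.exp_add]; push_cast; ring_nf
    have h2 : exp (((n - k : ℤ) : ℂ) * I * t) = exp (n * I * t) * exp (-(k * I * t)) := by
      rw [← Complex.exp_add]; push_cast; ring_nf
    rw [h1, h2, bohrKernel]
    push_cast
    ring
  simp_rw [h]
  have hc : ∀ (c : ℂ) (m : ℤ), IntervalIntegrable (fun t : ℝ => c * exp (m * I * t))
      MeasureTheory.volume 0 (2 * Real.pi) := fun c m =>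
    Continuous.intervalIntegrable (by fun_prop) _ _
  have hcast : (n : ℤ) + k ≠ 0 := by omega
  rw [intervalIntegral.integral_add ((hc _ _).add (hc _ _)) (hc _ _),
    intervalIntegral.integral_add (hc _ _) (hc _ _)]
  simp only [intervalIntegral.integral_const_mul, integral_exp_int_mul_I, hcast, if_false,
    sub_eq_zero, Nat.cast_inj, Nat.cast_eq_zero]
  split_ifs <;> ring

lemma integral_norm_bohrKernel {v : ℂ} (hv : ‖v‖ = 1) {k : ℕ} (hk : k ≠ 0) :
    ∫ t in (0 : ℝ)..2 * Real.pi, ‖bohrKernel v k t‖ = 2 * Real.pi * 2 := by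
  have h := integral_exp_mul_bohrKernel v hk 0
  simp only [Nat.cast_zero, zero_mul, Complex.exp_zero, one_mul, if_true, hk.symm, if_false,
    add_zero] at h
  rw [intervalIntegral.integral_congr fun t _ => bohrKernel_eq_norm hv k t,
    intervalIntegral.integral_ofReal] at h
  exact_mod_cast h

section BoundedPowerSeries

variable {f : ℂ → ℂ} {a : ℕ → ℂ} {M : ℝ}

lemma summable_norm_mul_pow_of_hasSum_ball
    (hsum : ∀ z ∈ ball (0 : ℂ) 1, HasSum (fun k : ℕ => a k * z ^ k) (f z))
    {r : ℝ} (hr : 0 ≤ r) (hr1 : r < 1) : Summable fun k : ℕ => ‖a k‖ * r ^ k := by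
  have hz : (r : ℂ) ∈ ball (0 : ℂ) 1 := by simpa [abs_of_nonneg hr] using hr1
  simpa [abs_of_nonneg hr] using (hsum _ hz).summable.norm

lemma integral_mul_bohrKernel
    (hsum : ∀ z ∈ ball (0 : ℂ) 1, HasSum (fun k : ℕ => a k * z ^ k) (f z))
    {r : ℝ} (hr : 0 ≤ r) (hr1 : r < 1) (v : ℂ) {k : ℕ} (hk : k ≠ 0) :
    ∫ t in (0 : ℝ)..2 * Real.pi, f (r * exp (t * I)) * bohrKernel v k t
      = 2 * Real.pi * (2 * a 0 + v * (a k * r ^ k)) := by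
  have hterm : ∀ (n : ℕ) (t : ℝ), a n * (r * exp (t * I)) ^ n * bohrKernel v k t
      = a n * r ^ n * (exp (n * I * t) * bohrKernel v k t) := by
    intro n t
    rw [mul_pow, ← Complex.exp_nat_mul]
    ring_nf
  have hnorm : ∀ t : ℝ, ‖(r : ℂ) * exp (t * I)‖ = r := by
    intro t
    rw [norm_mul, norm_exp_ofReal_mul_I, norm_real, Real.norm_of_nonneg hr, mul_one]
  obtain ⟨C, hC⟩ := (isCompact_uIcc (a := (0 : ℝ)) (b := 2 * Real.pi)).exists_bound_of_continuousOn
    (continuous_bohrKernel v k).continuousOn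
  have hint := intervalIntegral.hasSum_integral_of_dominated_convergence
    (μ := MeasureTheory.volume) (a := 0) (b := 2 * Real.pi)
    (F := fun (n : ℕ) (t : ℝ) => a n * (r * exp (t * I)) ^ n * bohrKernel v k t)
    (f := fun t : ℝ => f (r * exp (t * I)) * bohrKernel v k t)
    (fun n _ => ‖a n‖ * r ^ n * C)
    (fun n => by
      have := continuous_bohrKernel v k
      exact Continuous.aestronglyMeasurable (by fun_prop))
    (fun n => .of_forall fun t ht => by
      rw [norm_mul, norm_mul, norm_pow, hnorm]
      have := hC t (Set.uIoc_subset_uIcc ht)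
      gcongr)
    (.of_forall fun t _ => (summable_norm_mul_pow_of_hasSum_ball hsum hr hr1).mul_right C)
    (by simp)
    (.of_forall fun t _ => (hsum _ (by rwa [mem_ball_zero_iff, hnorm])).mul_right _)
  simp_rw [hterm, intervalIntegral.integral_const_mul, integral_exp_mul_bohrKernel v hk] at hint
  have hval : HasSum (fun n : ℕ => a n * (r : ℂ) ^ n *
      (2 * Real.pi * ((if n = 0 then 2 else 0) + if n = k then v else 0)))
      (2 * Real.pi * (2 * a 0 + v * (a k * r ^ k))) := by
    have h := ((hasSum_ite_eq (0 : ℕ) (2 * a 0)).add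
      (hasSum_ite_eq k (v * (a k * (r : ℂ) ^ k)))).mul_left (2 * (Real.pi : ℂ))
    refine h.congr_fun ?_
    intro n
    by_cases h0 : n = 0
    · subst h0
      simp [hk.symm]
      ring
    · by_cases hnk : n = k
      · subst hnk
        simp [h0]
        ring
      · simp [h0, hnk]
  exact hint.unique hval

/-- A Carathéodory-type coefficient bound for bounded power series on the disc. -/
lemma norm_coeff_le_two_mul_sub
    (hsum : ∀ z ∈ ball (0 : ℂ) 1, HasSum (fun k : ℕ => a k * z ^ k) (f z))
    (hM : ∀ z ∈ ball (0 : ℂ) 1, ‖f z‖ ≤ M) {k : ℕ} (hk : k ≠ 0) :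
    ‖a k‖ ≤ 2 * (M - ‖a 0‖) := by
  have hr : ∀ r : ℝ, 0 ≤ r → r < 1 → ‖a k‖ * r ^ k ≤ 2 * (M - ‖a 0‖) := by
    intro r hr hr1
    obtain ⟨v, hv, hadd⟩ := exists_norm_eq_one_norm_add_mul (2 * a 0) (a k * r ^ k)
    have hmem : ∀ t : ℝ, (r : ℂ) * exp (t * I) ∈ ball (0 : ℂ) 1 := by
      intro t
      rw [mem_ball_zero_iff, norm_mul, norm_exp_ofReal_mul_I, norm_real, Real.norm_of_nonneg hr,
        mul_one]
      exact hr1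
    have hKc := continuous_bohrKernel v k
    have hle : ‖∫ t in (0 : ℝ)..2 * Real.pi, f (r * exp (t * I)) * bohrKernel v k t‖
        ≤ ∫ t in (0 : ℝ)..2 * Real.pi, M * ‖bohrKernel v k t‖ := by
      refine intervalIntegral.norm_integral_le_of_norm_le (by positivity)
        (.of_forall fun t _ => ?_) (Continuous.intervalIntegrable (by fun_prop) _ _)
      rw [norm_mul]
      gcongr
      exact hM _ (hmem t)
    rw [integral_mul_bohrKernel hsum hr hr1 v hk, intervalIntegral.integral_const_mul,
      integral_norm_bohrKernel hv hk, norm_mul, hadd] at hle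
    simp only [norm_mul, norm_pow, norm_real, Real.norm_of_nonneg hr,
      Real.norm_of_nonneg Real.pi_pos.le, Complex.norm_ofNat] at hle
    have hpi := Real.two_pi_pos
    have : 2 * Real.pi * (2 * ‖a 0‖ + ‖a k‖ * r ^ k) ≤ 2 * Real.pi * (M * 2) := by linarith
    linarith [le_of_mul_le_mul_left this hpi]
  have hlim : Filter.Tendsto (fun r : ℝ => ‖a k‖ * r ^ k) (nhdsWithin 1 (Set.Iio 1))
      (nhds (‖a k‖ * 1 ^ k)) :=
    (Continuous.tendsto (by fun_prop) 1).mono_left nhdsWithin_le_nhds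
  rw [one_pow, mul_one] at hlim
  refine le_of_tendsto hlim ?_
  filter_upwards [Ioo_mem_nhdsLT (zero_lt_one' ℝ)] with r hr01
  exact hr r hr01.1.le hr01.2

end BoundedPowerSeries

/-- Bohr's inequality: if `f` is holomorphic and bounded on the unit disc with power
series `Σ aₖ zᵏ`, then for `0 ≤ r ≤ 1/3` one has `Σ |aₖ| rᵏ ≤ sup_{|z|<1} |f(z)|`. -/
theorem stmt_5 (f : ℂ → ℂ) (a : ℕ → ℂ)
    (hf : DifferentiableOn ℂ f (Metric.ball 0 1))
    (hsum : ∀ z ∈ Metric.ball (0 : ℂ) 1, HasSum (fun k : ℕ => a k * z ^ k) (f z))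
    (hbdd : BddAbove (Set.range fun z : Metric.ball (0 : ℂ) 1 => ‖f ↑z‖)) :
    ∀ r : ℝ, 0 ≤ r → r ≤ 1 / 3 →
      Summable (fun k : ℕ => ‖a k‖ * r ^ k) ∧
      ∑' k : ℕ, ‖a k‖ * r ^ k ≤ ⨆ z : Metric.ball (0 : ℂ) 1, ‖f ↑z‖ := by
  intro r hr hr3
  have hs := summable_norm_mul_pow_of_hasSum_ball hsum hr (by linarith)
  refine ⟨hs, ?_⟩
  set M := ⨆ z : Metric.ball (0 : ℂ) 1, ‖f ↑z‖
  have hM : ∀ z ∈ ball (0 : ℂ) 1, ‖f z‖ ≤ M := fun z hz => le_ciSup hbdd ⟨z, hz⟩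
  have hcoeff : ∀ k : ℕ, ‖a (k + 1)‖ ≤ 2 * (M - ‖a 0‖) := fun k =>
    norm_coeff_le_two_mul_sub hsum hM k.succ_ne_zero
  have hnonneg : 0 ≤ 2 * (M - ‖a 0‖) := (norm_nonneg _).trans (hcoeff 0)
  have hgeom : HasSum (fun k : ℕ => 2 * (M - ‖a 0‖) * (1 / 3) * (1 / 3 : ℝ) ^ k)
      (M - ‖a 0‖) := by
    have h := (hasSum_geometric_of_lt_one (r := (1 / 3 : ℝ)) (by norm_num) (by norm_num)).mul_left
      (2 * (M - ‖a 0‖) * (1 / 3))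
    rwa [show 2 * (M - ‖a 0‖) * (1 / 3) * (1 - 1 / 3 : ℝ)⁻¹ = M - ‖a 0‖ by ring] at h
  have htail : ∑' k : ℕ, ‖a (k + 1)‖ * r ^ (k + 1) ≤ M - ‖a 0‖ := by
    rw [← hgeom.tsum_eq]
    refine ((summable_nat_add_iff 1).mpr hs).tsum_le_tsum (fun k => ?_) hgeom.summable
    calc ‖a (k + 1)‖ * r ^ (k + 1) ≤ 2 * (M - ‖a 0‖) * (1 / 3) ^ (k + 1) := by
          gcongr
          exact hcoeff k
      _ = 2 * (M - ‖a 0‖) * (1 / 3) * (1 / 3) ^ k := by ring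
  rw [hs.tsum_eq_zero_add, pow_zero, mul_one]
  linarith
end

section
/- Let r > 0 and let F : ℂ[z] → ℂ be a ℂ-linear functional on the vector space of complex polynomials such that F(1) = 1 and F((z − α)ⁿ) ≠ 0 for every integer n ≥ 1 and every α ∈ ℂ with |α| ≥ r. Then there exists w ∈ ℂ with |w| < r such that F(p) = p(w) for every polynomial p ∈ ℂ[z]. -/
open Polynomial Filter Topology

/-- **Newton's identities** for the elements of a multiset. -/
theorem Multiset.succ_mul_esymm_eq_sum {R : Type*} [CommRing R] (s : Multiset R) (k : ℕ) :
    ((k : R) + 1) * s.esymm (k + 1) =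
      ∑ i ∈ Finset.range (k + 1),
        (-1) ^ (k + i) * s.esymm i * (s.map (· ^ (k + 1 - i))).sum := by
  obtain ⟨n, f, rfl⟩ : ∃ (n : ℕ) (f : Fin n → R), s = Finset.univ.val.map f := by
    induction s using Quotient.inductionOn with
    | h l => exact ⟨l.length, l.get, by simp [Fin.univ_val_map]⟩
  have newton := congrArg (MvPolynomial.aeval f) (MvPolynomial.mul_esymm_eq_sum (Fin n) R (k + 1))
  simp only [map_mul, map_natCast, MvPolynomial.aeval_esymm_eq_multiset_esymm, map_pow, map_neg,
    map_one, map_sum, MvPolynomial.psum, MvPolynomial.aeval_X] at newton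
  rw [Finset.sum_filter, Finset.Nat.sum_antidiagonal_eq_sum_range_succ_mk, Finset.sum_range_succ,
    if_neg (by simp), add_zero, Finset.mul_sum] at newton
  push_cast at newton
  rw [newton]
  refine Finset.sum_congr rfl fun i hi => ?_
  rw [if_pos (Finset.mem_range.mp hi), Multiset.map_map]
  simp only [Finset.sum, Function.comp_def]
  ring

theorem Multiset.norm_sum_map_pow_le {s : Multiset ℂ} {r : ℝ} (hs : ∀ x ∈ s, ‖x‖ ≤ r) (j : ℕ) :
    ‖(s.map (· ^ j)).sum‖ ≤ s.card * r ^ j := by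
  induction s using Multiset.induction with
  | empty => simp
  | cons x s ih =>
    have hx : ‖x ^ j‖ ≤ r ^ j := by
      rw [norm_pow]
      exact pow_le_pow_left₀ (norm_nonneg x) (hs x (Multiset.mem_cons_self x s)) j
    have ih' := ih fun y hy => hs y (Multiset.mem_cons_of_mem hy)
    rw [Multiset.map_cons, Multiset.sum_cons, Multiset.card_cons]
    push_cast
    linarith [norm_add_le (x ^ j) (s.map (· ^ j)).sum]

theorem tendsto_choose_div_pow (k : ℕ) :
    Tendsto (fun n : ℕ => (n.choose k : ℂ) / (n : ℂ) ^ k) atTop (𝓝 (1 / (k.factorial : ℂ))) := by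
  have h : Tendsto (fun n : ℕ => (n.choose k : ℝ) * ((n : ℝ)⁻¹) ^ k) atTop
      (𝓝 (1 ^ k / (k.factorial : ℝ))) := by
    refine ProbabilityTheory.tendsto_choose_mul_pow_atTop k ?_
    refine tendsto_const_nhds.congr' ?_
    filter_upwards [eventually_ne_atTop 0] with n hn
    field_simp
  have h' := (Complex.continuous_ofReal.tendsto _).comp h
  simpa [Function.comp_def, div_eq_mul_inv] using h'

/-- A sequence whose binomial multiples are, for every `n`, the elementary symmetric functions of
`n` points in a fixed disc satisfies the recurrence of a geometric sequence. -/
theorem eq_mul_of_forall_esymm_eq_choose_mul {a : ℕ → ℂ} {r : ℝ} (s : ℕ → Multiset ℂ)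
    (hcard : ∀ n, (s n).card = n) (hs : ∀ n, ∀ x ∈ s n, ‖x‖ ≤ r)
    (hesymm : ∀ n k, k ≤ n → (s n).esymm k = n.choose k * a k) (k : ℕ) :
    a (k + 1) = a k * a 1 := by
  have hsum : ∀ n, 1 ≤ n → ((s n).map (· ^ 1)).sum = n * a 1 := fun n hn => by
    have := hesymm n 1 hn
    simpa [Multiset.esymm, Multiset.powersetCard_one] using this
  have hpsum : ∀ j, 2 ≤ j →
      Tendsto (fun n : ℕ => ((s n).map (· ^ j)).sum / (n : ℂ) ^ j) atTop (𝓝 0) := by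
    intro j hj
    have hlim : Tendsto (fun n : ℕ => r ^ j * (1 / (n : ℝ))) atTop (𝓝 0) := by
      simpa using tendsto_one_div_atTop_nhds_zero_nat.const_mul (r ^ j)
    refine squeeze_zero_norm' ?_ hlim
    filter_upwards [eventually_ge_atTop 1] with n hn
    have hn' : (1 : ℝ) ≤ n := by exact_mod_cast hn
    have hle := Multiset.norm_sum_map_pow_le (hs n) j
    rw [hcard] at hle
    have hr : 0 ≤ r ^ j := by
      have := (norm_nonneg _).trans hle
      exact nonneg_of_mul_nonneg_right this (by linarith)
    have hpow : (n : ℝ) ^ 2 ≤ (n : ℝ) ^ j := pow_le_pow_right₀ hn' hj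
    rw [norm_div, norm_pow, Complex.norm_natCast]
    calc _ ≤ (n * r ^ j) / (n : ℝ) ^ 2 := by gcongr
      _ = r ^ j * (1 / (n : ℝ)) := by field_simp
  have hleft : Tendsto (fun n : ℕ => ((k : ℂ) + 1) * ((n.choose (k + 1) : ℂ) / (n : ℂ) ^ (k + 1)
      * a (k + 1))) atTop (𝓝 (((k : ℂ) + 1) * (1 / ((k + 1).factorial : ℂ) * a (k + 1)))) :=
    ((tendsto_choose_div_pow (k + 1)).mul_const _).const_mul _
  have hright : Tendsto (fun n : ℕ => (∑ i ∈ Finset.range k, (-1) ^ (k + i) *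
      ((n.choose i : ℂ) / (n : ℂ) ^ i * a i) *
        (((s n).map (· ^ (k + 1 - i))).sum / (n : ℂ) ^ (k + 1 - i))) +
      (n.choose k : ℂ) / (n : ℂ) ^ k * a k * a 1) atTop
      (𝓝 ((∑ i ∈ Finset.range k, (-1) ^ (k + i) * (1 / (i.factorial : ℂ) * a i) * 0) +
        1 / (k.factorial : ℂ) * a k * a 1)) := by
    refine Tendsto.add (tendsto_finsetSum _ fun i hi => ?_)
      (((tendsto_choose_div_pow k).mul_const _).mul_const _)
    have := Finset.mem_range.mp hi
    exact (((tendsto_choose_div_pow i).mul_const _).const_mul _).mul (hpsum _ (by omega))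
  have hlimits := tendsto_nhds_unique_of_eventuallyEq hleft hright ?_
  · have hk : (k.factorial : ℂ) ≠ 0 := by exact_mod_cast k.factorial_ne_zero
    have hk' : (k : ℂ) + 1 ≠ 0 := by exact_mod_cast k.succ_ne_zero
    rw [Nat.factorial_succ] at hlimits
    push_cast at hlimits
    simp only [mul_zero, Finset.sum_const_zero, zero_add] at hlimits
    field_simp at hlimits
    exact hlimits
  · filter_upwards [eventually_ge_atTop (k + 1)] with n hn
    have hn0 : (n : ℂ) ≠ 0 := by exact_mod_cast (by omega : n ≠ 0)
    have newton := (s n).succ_mul_esymm_eq_sum k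
    rw [Finset.sum_range_succ, hesymm n (k + 1) hn, Nat.add_sub_cancel_left,
      hsum n (by omega), hesymm n k (by omega), ← two_mul, pow_mul] at newton
    have hdiv := congrArg (· / (n : ℂ) ^ (k + 1)) newton
    simp only [add_div, Finset.sum_div] at hdiv
    convert! hdiv using 1
    · ring
    · congr 1
      · refine Finset.sum_congr rfl fun i hi => ?_
        have hik := Finset.mem_range.mp hi
        have hpow : (n : ℂ) ^ (k + 1) = (n : ℂ) ^ i * (n : ℂ) ^ (k + 1 - i) := by
          rw [← pow_add]; congr 1; omega
        rw [hesymm n i (by omega), hpow]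
        field_simp
      · rw [pow_succ]
        simp
        field_simp

/-- The monic Appell polynomial `α ↦ F ((α - z) ^ n)` of a linear functional `F`. -/
noncomputable def appell (F : ℂ[X] →ₗ[ℂ] ℂ) (n : ℕ) : ℂ[X] :=
  ∑ m ∈ Finset.range (n + 1), C ((-1) ^ (n - m) * n.choose (n - m) * F (X ^ (n - m))) * X ^ m

theorem appell_coeff (F : ℂ[X] →ₗ[ℂ] ℂ) {n m : ℕ} (h : m ≤ n) :
    (appell F n).coeff m = (-1) ^ (n - m) * n.choose (n - m) * F (X ^ (n - m)) := by
  simp only [appell, finsetSum_coeff, coeff_C_mul_X_pow]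
  rw [Finset.sum_ite_eq, if_pos (Finset.mem_range.mpr (by omega))]

theorem appell_natDegree {F : ℂ[X] →ₗ[ℂ] ℂ} (hF1 : F 1 = 1) (n : ℕ) :
    (appell F n).natDegree = n := by
  refine natDegree_eq_of_le_of_coeff_ne_zero ?_ (by simp [appell_coeff, hF1])
  refine natDegree_sum_le_of_forall_le _ _ fun m hm => (natDegree_C_mul_X_pow_le _ _).trans ?_
  have := Finset.mem_range.mp hm
  omega

theorem appell_monic {F : ℂ[X] →ₗ[ℂ] ℂ} (hF1 : F 1 = 1) (n : ℕ) : (appell F n).Monic := by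
  rw [Monic, leadingCoeff, appell_natDegree hF1, appell_coeff F le_rfl]
  simp [hF1]

theorem appell_eval (F : ℂ[X] →ₗ[ℂ] ℂ) (n : ℕ) (α : ℂ) :
    (appell F n).eval α = (-1) ^ n * F ((X - C α) ^ n) := by
  have hneg : (-1 : ℂ) ^ n * F ((X - C α) ^ n) = F ((C α + -X) ^ n) := by
    rw [← smul_eq_mul, ← map_smul, smul_eq_C_mul, map_pow, ← mul_pow]
    congr 2
    simp [sub_eq_add_neg]
  rw [hneg, add_pow, map_sum, appell, eval_finsetSum]
  refine Finset.sum_congr rfl fun m hm => ?_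
  have hmn : m ≤ n := Nat.lt_succ_iff.mp (Finset.mem_range.mp hm)
  have hterm : (C α ^ m * (-X) ^ (n - m) * (n.choose m : ℂ[X])) =
      (α ^ m * (-1) ^ (n - m) * n.choose m) • X ^ (n - m) := by
    rw [neg_pow, smul_eq_C_mul]
    simp
    ring
  rw [hterm, map_smul, smul_eq_mul, Nat.choose_symm hmn]
  simp
  ring

theorem appell_esymm_roots {F : ℂ[X] →ₗ[ℂ] ℂ} (hF1 : F 1 = 1) {n k : ℕ} (h : k ≤ n) :
    (appell F n).roots.esymm k = n.choose k * F (X ^ k) := by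
  have hvieta := coeff_eq_esymm_roots_of_splits (IsAlgClosed.splits (appell F n))
    (k := n - k) (by rw [appell_natDegree hF1]; omega)
  rw [appell_natDegree hF1, (appell_monic hF1 n).leadingCoeff, appell_coeff F (Nat.sub_le n k),
    Nat.sub_sub_self h, one_mul, mul_assoc] at hvieta
  exact (mul_left_cancel₀ (pow_ne_zero k (neg_ne_zero.mpr one_ne_zero)) hvieta).symm

/-- GKZ-type theorem for polynomials: a linear functional `F` on `ℂ[z]` with `F(1) = 1`
and `F((z - α)ⁿ) ≠ 0` for all `n ≥ 1` and all `|α| ≥ r` is a point evaluation at some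
point `w` with `|w| < r`. -/
theorem stmt_6 (r : ℝ) (hr : 0 < r) (F : Polynomial ℂ →ₗ[ℂ] ℂ)
    (hF1 : F 1 = 1)
    (hF : ∀ n : ℕ, 1 ≤ n → ∀ α : ℂ, r ≤ ‖α‖ →
      F ((Polynomial.X - Polynomial.C α) ^ n) ≠ 0) :
    ∃ w : ℂ, ‖w‖ < r ∧ ∀ p : Polynomial ℂ, F p = p.eval w := by
  have hroots : ∀ n, ∀ α ∈ (appell F n).roots, ‖α‖ ≤ r := by
    intro n α hα
    have hroot := (mem_roots'.mp hα).2
    rw [IsRoot, appell_eval] at hroot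
    by_contra! hlt
    rcases Nat.eq_zero_or_pos n with rfl | hn
    · simp [hF1] at hroot
    · exact hF n hn α hlt.le (by simpa using hroot)
  have hrec := eq_mul_of_forall_esymm_eq_choose_mul (a := fun k => F (X ^ k))
    (fun n => (appell F n).roots)
    (fun n => (splits_iff_card_roots.mp (IsAlgClosed.splits _)).trans (appell_natDegree hF1 n))
    hroots (fun n k h => appell_esymm_roots hF1 h)
  have hpow : ∀ k, F (X ^ k) = F X ^ k := by
    intro k
    induction k with
    | zero => simpa using hF1
    | succ k ih => simpa [ih, pow_succ] using hrec k
  have hC : ∀ c : ℂ, F (C c) = c := fun c => by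
    rw [← mul_one (C c), ← smul_eq_C_mul, map_smul, hF1, smul_eq_mul, mul_one]
  refine ⟨F X, ?_, fun p => ?_⟩
  · by_contra! hle
    exact hF 1 le_rfl (F X) hle (by rw [pow_one, map_sub, hC, sub_self])
  · induction p using Polynomial.induction_on' with
    | add p q hp hq => rw [map_add, eval_add, hp, hq]
    | monomial n c =>
      rw [← C_mul_X_pow_eq_monomial, ← smul_eq_C_mul, map_smul, hpow]
      simp
end

section
/- Let X be a finite-dimensional real normed space and let T, A : X → X be linear operators. Suppose the norm attainment set M_T = { x ∈ X : ‖x‖ = 1, ‖Tx‖ = ‖T‖ } has the form M_T = D ∪ (−D) for some nonempty connected subset D of the unit sphere of X. If T is Birkhoff–James orthogonal to A (i.e., ‖T + λA‖ ≥ ‖T‖ for all λ ∈ ℝ, where ‖·‖ is the operator norm), then there exists x ∈ M_T such that Tx is Birkhoff–James orthogonal to Ax (i.e., ‖Tx + λ Ax‖ ≥ ‖Tx‖ for all λ ∈ ℝ). -/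
/-- A ray starting in the ball of radius `c` that has left its interior stays outside. -/
theorem le_norm_add_smul_of_le {E : Type*} [NormedAddCommGroup E] [NormedSpace ℝ E]
    {u v : E} {c s t : ℝ} (hu : ‖u‖ ≤ c) (hs : 0 < s) (hst : s ≤ t) (h : c ≤ ‖u + s • v‖) :
    c ≤ ‖u + t • v‖ := by
  have key : t • (u + s • v) = (t - s) • u + s • (u + t • v) := by module
  have hn := norm_add_le ((t - s) • u) (s • (u + t • v))
  rw [← key, norm_smul, norm_smul, norm_smul, Real.norm_of_nonneg (hs.le.trans hst),
    Real.norm_of_nonneg (sub_nonneg.2 hst), Real.norm_of_nonneg hs.le] at hn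
  have h1 := mul_le_mul_of_nonneg_left h (hs.le.trans hst)
  have h2 := mul_le_mul_of_nonneg_left hu (sub_nonneg.2 hst)
  exact le_of_mul_le_mul_left (by linarith) hs

/-- The norm cannot decrease in both directions along a line. -/
theorem norm_le_norm_add_smul_or_neg {E : Type*} [NormedAddCommGroup E] [NormedSpace ℝ E]
    (u v : E) :
    (∀ t : ℝ, 0 < t → ‖u‖ ≤ ‖u + t • v‖) ∨ (∀ t : ℝ, 0 < t → ‖u‖ ≤ ‖u + t • (-v)‖) := by
  by_contra! ⟨⟨s, hs, hsu⟩, t, ht, htu⟩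
  have key : (s + t) • u = t • (u + s • v) + s • (u + t • (-v)) := by module
  have hn := norm_add_le (t • (u + s • v)) (s • (u + t • (-v)))
  rw [← key, norm_smul, norm_smul, norm_smul, Real.norm_of_nonneg (by positivity),
    Real.norm_of_nonneg ht.le, Real.norm_of_nonneg hs.le] at hn
  have h1 := mul_lt_mul_of_pos_left hsu ht
  have h2 := mul_lt_mul_of_pos_left htu hs
  linarith

theorem ContinuousLinearMap.exists_norm_eq_one_opNorm_le {E F : Type*} [NormedAddCommGroup E]
    [NormedSpace ℝ E] [FiniteDimensional ℝ E] [Nontrivial E] [NormedAddCommGroup F]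
    [NormedSpace ℝ F] (S : E →L[ℝ] F) : ∃ x : E, ‖x‖ = 1 ∧ ‖S‖ ≤ ‖S x‖ := by
  have : ProperSpace E := FiniteDimensional.proper ℝ E
  obtain ⟨x, hx, hmax⟩ := (isCompact_sphere (0 : E) 1).exists_isMaxOn
    (NormedSpace.sphere_nonempty.2 zero_le_one) (f := fun x => ‖S x‖) (by fun_prop)
  refine ⟨x, by simpa using hx, S.opNorm_le_of_unit_norm (norm_nonneg _) fun y hy => ?_⟩
  exact hmax (by simpa using hy)

/-- If `‖T + t • B‖ ≥ ‖T‖` for all `t > 0`, then some unit vector `x` satisfies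
`‖T x + t • B x‖ ≥ ‖T‖` for all `t > 0` simultaneously. -/
theorem ContinuousLinearMap.exists_forall_opNorm_le_norm_add_smul {E F : Type*}
    [NormedAddCommGroup E] [NormedSpace ℝ E] [FiniteDimensional ℝ E] [Nontrivial E]
    [NormedAddCommGroup F] [NormedSpace ℝ F] (T B : E →L[ℝ] F)
    (h : ∀ t : ℝ, 0 < t → ‖T‖ ≤ ‖T + t • B‖) :
    ∃ x : E, ‖x‖ = 1 ∧ ∀ t : ℝ, 0 < t → ‖T‖ ≤ ‖T x + t • B x‖ := by
  have : ProperSpace E := FiniteDimensional.proper ℝ E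
  have hpos (n : ℕ) : (0 : ℝ) < 1 / ((n : ℝ) + 1) := Nat.one_div_pos_of_nat
  choose x hx hle using fun n : ℕ =>
    (T + (1 / ((n : ℝ) + 1)) • B).exists_norm_eq_one_opNorm_le
  obtain ⟨a, ha, φ, hφ, hlim⟩ := (isCompact_sphere (0 : E) 1).tendsto_subseq
    (x := x) (fun n => by simpa using hx n)
  refine ⟨a, by simpa using ha, fun t ht => ?_⟩
  have hcont : Continuous fun y : E => ‖T y + t • B y‖ := by fun_prop
  refine ge_of_tendsto ((hcont.tendsto a).comp hlim) ?_
  have hsmall : ∀ᶠ n : ℕ in Filter.atTop, 1 / ((φ n : ℝ) + 1) < t :=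
    (tendsto_one_div_add_atTop_nhds_zero_nat.comp hφ.tendsto_atTop).eventually_lt_const ht
  filter_upwards [hsmall] with n hn
  exact le_norm_add_smul_of_le (T.unit_le_opNorm _ (hx _).le) (hpos _) hn.le
    ((h _ (hpos _)).trans (hle _))

/-- The point of `exists_forall_opNorm_le_norm_add_smul` may be taken in any `D` such that the norm
attainment set of `T` is contained in `D ∪ -D`. -/
theorem ContinuousLinearMap.exists_mem_forall_opNorm_le_norm_add_smul {E F : Type*}
    [NormedAddCommGroup E] [NormedSpace ℝ E] [FiniteDimensional ℝ E] [Nontrivial E]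
    [NormedAddCommGroup F] [NormedSpace ℝ F] (T B : E →L[ℝ] F) {D : Set E}
    (hD : {x : E | ‖x‖ = 1 ∧ ‖T x‖ = ‖T‖} ⊆ D ∪ -D)
    (h : ∀ t : ℝ, 0 < t → ‖T‖ ≤ ‖T + t • B‖) :
    ∃ x ∈ D, ∀ t : ℝ, 0 < t → ‖T‖ ≤ ‖T x + t • B x‖ := by
  obtain ⟨x, hx, hxB⟩ := T.exists_forall_opNorm_le_norm_add_smul B h
  have hTx : ‖T‖ ≤ ‖T x‖ := by
    have hcont : Continuous fun t : ℝ => ‖T x + t • B x‖ := by fun_prop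
    have hlim := (hcont.tendsto 0).mono_left (nhdsWithin_le_nhds (s := Set.Ioi 0))
    simp only [zero_smul, add_zero] at hlim
    exact ge_of_tendsto hlim (eventually_mem_nhdsWithin.mono hxB)
  rcases hD ⟨hx, (T.unit_le_opNorm x hx.le).antisymm hTx⟩ with hxD | hxD
  · exact ⟨x, hxD, hxB⟩
  · refine ⟨-x, hxD, fun t ht => ?_⟩
    rw [map_neg, map_neg, smul_neg, ← neg_add, norm_neg]
    exact hxB t ht

/-- If the norm attainment set of `T` has the form `D ∪ (−D)` for a nonempty connected
subset `D` of the unit sphere, and `T` is Birkhoff–James orthogonal to `A`, then there is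
`x ∈ M_T` with `Tx` Birkhoff–James orthogonal to `Ax`. -/
theorem stmt_8 {X : Type*} [NormedAddCommGroup X] [NormedSpace ℝ X] [FiniteDimensional ℝ X]
    (T A : X →L[ℝ] X) (D : Set X) (hD : IsConnected D)
    (hDsphere : D ⊆ Metric.sphere (0 : X) 1)
    (hMT : {x : X | ‖x‖ = 1 ∧ ‖T x‖ = ‖T‖} = D ∪ -D)
    (hBJ : ∀ lam : ℝ, ‖T‖ ≤ ‖T + lam • A‖) :
    ∃ x : X, ‖x‖ = 1 ∧ ‖T x‖ = ‖T‖ ∧ ∀ lam : ℝ, ‖T x‖ ≤ ‖T x + lam • A x‖ := by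
  have hMD : ∀ x ∈ D, ‖x‖ = 1 ∧ ‖T x‖ = ‖T‖ := fun x hx => hMT.superset (Or.inl hx)
  obtain ⟨x₀, hx₀⟩ := hD.nonempty
  have : Nontrivial X := nontrivial_of_ne x₀ 0 <| by
    rintro rfl
    simpa using (hMD 0 hx₀).1
  have hclosed (B : X →L[ℝ] X) :
      IsClosed {x : X | ∀ t : ℝ, 0 < t → ‖T‖ ≤ ‖T x + t • B x‖} := by
    simp only [Set.ofPred_forall]
    exact isClosed_iInter fun t => isClosed_iInter fun _ =>
      isClosed_le continuous_const (by fun_prop)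
  obtain ⟨x, hxD, hpos, hneg⟩ := isPreconnected_closed_iff.1 hD.isPreconnected _ _
    (hclosed A) (hclosed (-A))
    (fun x hx => by
      have := norm_le_norm_add_smul_or_neg (T x) (A x)
      rwa [(hMD x hx).2] at this)
    (T.exists_mem_forall_opNorm_le_norm_add_smul A hMT.subset fun t _ => hBJ t)
    (T.exists_mem_forall_opNorm_le_norm_add_smul (-A) hMT.subset fun t _ => by
      simpa using hBJ (-t))
  refine ⟨x, (hMD x hxD).1, (hMD x hxD).2, fun lam => ?_⟩
  rw [(hMD x hxD).2]
  rcases lt_trichotomy lam 0 with h | rfl | h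
  · simpa using hneg (-lam) (neg_pos.2 h)
  · simp [(hMD x hxD).2]
  · exact hpos lam h
end

section
/- Let X be a finite-dimensional real normed space. Then the norm of X arises from an inner product (i.e., X is a Hilbert space) if and only if for every linear operator T : X → X there exists a linear subspace V ⊆ X such that the norm attainment set M_T equals the unit sphere of V, i.e., M_T = { x ∈ V : ‖x‖ = 1 }. -/
open MeasureTheory Module

/-- Every operator on `X` attains its norm exactly on the unit sphere of a subspace. -/
def NormAttainmentIsSubspace (X : Type*) [NormedAddCommGroup X] [NormedSpace ℝ X] : Prop :=
  ∀ T : X →L[ℝ] X, ∃ V : Submodule ℝ X,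
    {x : X | ‖x‖ = 1 ∧ ‖T x‖ = ‖T‖} = {x : X | x ∈ V ∧ ‖x‖ = 1}

section Attainment

variable {E F : Type*} [NormedAddCommGroup E] [NormedSpace ℝ E] [FiniteDimensional ℝ E]
  [Nontrivial E] [NormedAddCommGroup F] [NormedSpace ℝ F]

theorem exists_norm_eq_one_norm_apply_eq_opNorm (f : E →L[ℝ] F) :
    ∃ x : E, ‖x‖ = 1 ∧ ‖f x‖ = ‖f‖ := by
  have : ProperSpace E := FiniteDimensional.proper ℝ E
  obtain ⟨x, hx, hmax⟩ := (isCompact_sphere (0 : E) 1).exists_isMaxOn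
    (NormedSpace.sphere_nonempty.mpr zero_le_one) (f.continuous.norm.continuousOn)
  have hx1 : ‖x‖ = 1 := by simpa using hx
  refine ⟨x, hx1, le_antisymm (f.unit_le_opNorm x hx1.le) ?_⟩
  refine f.opNorm_le_of_unit_norm (norm_nonneg _) fun y hy => hmax ?_
  simpa using hy

theorem exists_norm_eq_one_apply_eq_norm (f : E →L[ℝ] ℝ) : ∃ x : E, ‖x‖ = 1 ∧ f x = ‖f‖ := by
  obtain ⟨x, hx, hfx⟩ := exists_norm_eq_one_norm_apply_eq_opNorm f
  rcases abs_choice (f x) with h | h <;> rw [Real.norm_eq_abs, h] at hfx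
  · exact ⟨x, hx, hfx⟩
  · exact ⟨-x, by simpa using hx, by simpa using hfx⟩

end Attainment

section General

variable {X : Type*} [NormedAddCommGroup X] [NormedSpace ℝ X]

/-- Faces of the unit ball are singletons. -/
theorem NormAttainmentIsSubspace.eq_of_apply_eq_one (hX : NormAttainmentIsSubspace X)
    {f : X →L[ℝ] ℝ} (hf : ‖f‖ = 1) {x y : X} (hx : ‖x‖ = 1) (hy : ‖y‖ = 1)
    (hfx : f x = 1) (hfy : f y = 1) : x = y := by
  obtain ⟨V, hV⟩ := hX (f.smulRight x)
  have mem_V {z : X} (hz : ‖z‖ = 1) : |f z| = 1 ↔ z ∈ V := by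
    simpa [hz, hf, hx, norm_smul] using Set.ext_iff.mp hV z
  by_contra hxy
  have hsub : x - y ∈ V :=
    V.sub_mem ((mem_V hx).mp (by simp [hfx])) ((mem_V hy).mp (by simp [hfy]))
  have := (mem_V (norm_smul_inv_norm (𝕜 := ℝ) (sub_ne_zero.mpr hxy))).mpr (V.smul_mem _ hsub)
  simp [hfx, hfy] at this

theorem InnerProductSpaceable.normAttainmentIsSubspace [InnerProductSpaceable X] :
    NormAttainmentIsSubspace X := by
  intro T
  refine ⟨{ carrier := {x | ‖T x‖ = ‖T‖ * ‖x‖}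
            zero_mem' := by simp
            add_mem' := fun {x y} hx hy => ?_
            smul_mem' := fun c x hx => ?_ }, ?_⟩
  · simp only [Set.mem_ofPred_eq] at hx hy ⊢
    have h1 := InnerProductSpaceable.parallelogram_identity (T x) (T y)
    have h2 := InnerProductSpaceable.parallelogram_identity x y
    rw [← map_add, ← map_sub, hx, hy] at h1
    have hadd := T.le_opNorm (x + y)
    have hsub := T.le_opNorm (x - y)
    have hsub2 := mul_self_le_mul_self (norm_nonneg _) hsub
    refine le_antisymm hadd (abs_le_of_sq_le_sq' ?_ (norm_nonneg _) |>.2)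
    linear_combination hsub2 - h1 + ‖T‖ * ‖T‖ * h2
  · simp only [Set.mem_ofPred_eq, map_smul, norm_smul] at hx ⊢
    rw [hx]
    ring
  · ext x
    simp only [Set.mem_ofPred_eq, Submodule.mem_mk, AddSubmonoid.mem_mk]
    constructor
    · rintro ⟨hx, h⟩
      exact ⟨by simpa [hx] using h, hx⟩
    · rintro ⟨h, hx⟩
      exact ⟨hx, by simpa [hx] using h⟩

end General

section FiniteDimensional

variable {X : Type*} [NormedAddCommGroup X] [NormedSpace ℝ X] [FiniteDimensional ℝ X]

/-- If no perturbation vanishing on a proper subspace is invisible to `φ`, then `φ` attains its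
norm at an isometry. -/
theorem NormAttainmentIsSubspace.exists_isometry_apply_eq_norm [Nontrivial X]
    (hX : NormAttainmentIsSubspace X) (φ : (X →L[ℝ] X) →L[ℝ] ℝ)
    (hφ : ∀ V : Submodule ℝ X, V ≠ ⊤ → ∃ S : X →L[ℝ] X, (∀ v ∈ V, S v = 0) ∧ φ S ≠ 0) :
    ∃ T : X →L[ℝ] X, (∀ x, ‖T x‖ = ‖x‖) ∧ φ T = ‖φ‖ := by
  have : ProperSpace X := FiniteDimensional.proper ℝ X
  obtain ⟨T, hT, hφT⟩ := exists_norm_eq_one_apply_eq_norm φ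
  refine ⟨T, ?_, hφT⟩
  obtain ⟨V, hV⟩ := hX T
  have mem_V {x : X} (hx : ‖x‖ = 1) : ‖T x‖ = 1 ↔ x ∈ V := by
    simpa [hx, hT] using Set.ext_iff.mp hV x
  suffices V = ⊤ by
    subst this
    intro x
    rcases eq_or_ne x 0 with rfl | hx
    · simp
    have := (mem_V (norm_smul_inv_norm (𝕜 := ℝ) hx)).mpr trivial
    have hx' : ‖x‖ ≠ 0 := by simpa using hx
    simp only [map_smul, norm_smul] at this
    simp at this
    field_simp at this
    exact this
  by_contra hne
  obtain ⟨S, hSV, hS⟩ : ∃ S : X →L[ℝ] X, (∀ v ∈ V, S v = 0) ∧ 0 < φ S := by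
    obtain ⟨S, hSV, hS⟩ := hφ V hne
    rcases hS.lt_or_gt with h | h
    · exact ⟨-S, by simpa using hSV, by simpa using h⟩
    · exact ⟨S, hSV, h⟩
  have hm : 0 < ‖φ‖ :=
    pos_of_mul_pos_left (hS.trans_le ((le_abs_self _).trans (φ.le_opNorm S))) (norm_nonneg S)
  obtain ⟨c, hc, hcφ⟩ : ∃ c : ℝ, 0 < c ∧ φ S = ‖φ‖ * c := ⟨φ S / ‖φ‖, by positivity, by field_simp⟩
  have hgrow (ε : ℝ) : 1 + ε * c ≤ ‖T + ε • S‖ := by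
    have h : φ (T + ε • S) ≤ ‖φ‖ * ‖T + ε • S‖ := (le_abs_self _).trans (φ.le_opNorm _)
    simp only [map_add, map_smul, hφT, hcφ, smul_eq_mul] at h
    refine le_of_mul_le_mul_left ?_ hm
    linarith
  let K : Set X := Metric.sphere 0 1 ∩ {x | c ≤ ‖S x‖}
  have hK : IsCompact K :=
    (isCompact_sphere 0 1).inter_right (isClosed_le continuous_const S.continuous.norm)
  obtain ⟨M, hM, hMK⟩ : ∃ M < 1, ∀ x ∈ K, ‖T x‖ ≤ M := by
    rcases K.eq_empty_or_nonempty with h | h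
    · exact ⟨0, zero_lt_one, by simp [h]⟩
    obtain ⟨x, hx, hmax⟩ := hK.exists_isMaxOn h T.continuous.norm.continuousOn
    refine ⟨‖T x‖, ?_, fun y hy => hmax hy⟩
    have hx1 : ‖x‖ = 1 := by simpa using hx.1
    refine lt_of_le_of_ne (hT ▸ T.unit_le_opNorm x hx1.le) fun h => ?_
    have h0 : c ≤ ‖S x‖ := hx.2
    rw [hSV x ((mem_V hx1).mp h), norm_zero] at h0
    linarith
  obtain ⟨ε, hε, hεM⟩ : ∃ ε : ℝ, 0 < ε ∧ M + ε * ‖S‖ < 1 := by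
    refine ⟨(1 - M) / (‖S‖ + 1), div_pos (by linarith) (by positivity), ?_⟩
    have : (1 - M) / (‖S‖ + 1) * ‖S‖ < 1 - M := by
      rw [div_mul_eq_mul_div, div_lt_iff₀ (by positivity)]
      nlinarith
    linarith
  obtain ⟨x, hx, hxε⟩ := exists_norm_eq_one_norm_apply_eq_opNorm (T + ε • S)
  have hle : 1 + ε * c ≤ ‖T x‖ + ε * ‖S x‖ := by
    calc 1 + ε * c ≤ ‖T x + ε • S x‖ := by simpa [← hxε] using hgrow ε
      _ ≤ ‖T x‖ + ‖ε • S x‖ := norm_add_le _ _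
      _ = ‖T x‖ + ε * ‖S x‖ := by rw [norm_smul, Real.norm_of_nonneg hε.le]
  have hTx : ‖T x‖ ≤ 1 := hT ▸ T.unit_le_opNorm x hx.le
  have hSx : ‖S x‖ ≤ ‖S‖ := S.unit_le_opNorm x hx.le
  have hxK : x ∈ K := ⟨by simpa using hx, le_of_mul_le_mul_left (by linarith) hε⟩
  have := hMK x hxK
  nlinarith [mul_pos hε hc]

theorem NormAttainmentIsSubspace.exists_isometry_apply_eq_one (hX : NormAttainmentIsSubspace X)
    {x : X} (hx : ‖x‖ = 1) {g : X →L[ℝ] ℝ} (hg : ‖g‖ = 1) (hgx : 0 ≤ g x) :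
    ∃ T : X →L[ℝ] X, (∀ z, ‖T z‖ = ‖z‖) ∧ g (T x) = 1 := by
  have hx0 : x ≠ 0 := by rintro rfl; simp at hx
  have : Nontrivial X := nontrivial_of_ne x 0 hx0
  have : ProperSpace (X →L[ℝ] X) := FiniteDimensional.proper ℝ _
  let tr : (X →L[ℝ] X) →L[ℝ] ℝ :=
    LinearMap.toContinuousLinearMap (LinearMap.trace ℝ X ∘ₗ ContinuousLinearMap.coeLM ℝ)
  have tr_smulRight (h : X →L[ℝ] ℝ) (w : X) : tr (h.smulRight w) = h w :=
    LinearMap.trace_smulRight (h : X →ₗ[ℝ] ℝ) w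
  let ev : (X →L[ℝ] X) →L[ℝ] ℝ := g ∘L ContinuousLinearMap.apply ℝ X x
  have ev_apply (S : X →L[ℝ] X) : ev S = g (S x) := rfl
  let G : Set (X →L[ℝ] X) := {T | ∀ z, ‖T z‖ = ‖z‖}
  have hG1 (T : X →L[ℝ] X) (hT : T ∈ G) : ‖T‖ ≤ 1 :=
    T.opNorm_le_bound zero_le_one fun z => by rw [hT z, one_mul]
  have hGc : IsCompact G := by
    refine (isCompact_closedBall (0 : X →L[ℝ] X) 1).of_isClosed_subset ?_ fun T hT => ?_
    · simp only [G, Set.ofPred_forall]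
      exact isClosed_iInter fun z => isClosed_eq (by fun_prop) continuous_const
    · simpa using hG1 T hT
  obtain ⟨T, hT, hmax⟩ := hGc.exists_isMaxOn ⟨.id ℝ X, fun z => rfl⟩ ev.continuous.continuousOn
  refine ⟨T, hT, le_antisymm ?_ ?_⟩
  · calc g (T x) ≤ ‖g‖ * ‖T x‖ := (le_abs_self _).trans (g.le_opNorm _)
      _ = 1 := by rw [hT, hg, hx, one_mul]
  obtain ⟨f, hf, hfx⟩ := exists_dual_vector ℝ x (by simpa using hx0)
  obtain ⟨y, hy, hgy⟩ := exists_norm_eq_one_apply_eq_norm g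
  have key (t : ℝ) (ht : 0 < t) : 1 ≤ g (T x) + t * (2 * ‖tr‖) := by
    obtain ⟨U, hU, hUφ⟩ := hX.exists_isometry_apply_eq_norm (ev + t • tr) fun V hV => by
      obtain ⟨h, hh0, hhV⟩ := V.exists_le_ker_of_lt_top hV.lt_top
      by_contra! hcon
      have hzero (w : X) : h x * g w + t * h w = 0 := by
        have := hcon ((LinearMap.toContinuousLinearMap h).smulRight w) fun v hv => by
          simp [LinearMap.mem_ker.mp (hhV hv)]
        simpa [ev_apply, tr_smulRight] using this
      have hhx : h x = 0 := by
        have h1 : h x * (g x + t) = 0 := by linarith [hzero x]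
        exact (mul_eq_zero.mp h1).resolve_right (by positivity)
      refine hh0 (LinearMap.ext fun w => ?_)
      simpa [hhx, ht.ne'] using hzero w
    let R : X →L[ℝ] X := f.smulRight y
    have hR : ‖R‖ = 1 := by simp [R, hf, hy]
    have h1 : (ev + t • tr) R ≤ (ev + t • tr) U := by
      calc (ev + t • tr) R ≤ ‖ev + t • tr‖ * ‖R‖ := (le_abs_self _).trans ((ev + t • tr).le_opNorm R)
        _ = _ := by rw [hR, mul_one, hUφ]
    have h2 : ev R = 1 := by simp [ev_apply, R, hfx, hx, hgy, hg]
    have h3 : -‖tr‖ ≤ tr R := by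
      have := (neg_abs_le _).trans' (neg_le_neg (tr.le_opNorm R))
      simpa [hR] using this
    have h4 : tr U ≤ ‖tr‖ := (le_abs_self _).trans (tr.unit_le_opNorm U (hG1 U hU))
    have h5 : g (U x) ≤ g (T x) := hmax hU
    simp only [add_apply, smul_apply, smul_eq_mul,
      h2] at h1
    rw [ev_apply] at h1
    nlinarith
  refine le_of_forall_pos_le_add fun δ hδ => (key (δ / (2 * ‖tr‖ + 1)) (by positivity)).trans ?_
  gcongr
  rw [div_mul_eq_mul_div, div_le_iff₀ (by positivity)]
  nlinarith

/-- The isometry group of `X` preserves a bilinear form that is positive on nonzero vectors. -/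
theorem exists_pos_bilin_isometry_invariant :
    ∃ b : X →ₗ[ℝ] X →ₗ[ℝ] ℝ, (∀ x, x ≠ 0 → 0 < b x x) ∧
      ∀ (T : X ≃ₗᵢ[ℝ] X) (x : X), b (T x) (T x) = b x x := by
  have : ProperSpace X := FiniteDimensional.proper ℝ X
  borelize X
  let μ : Measure X := Measure.hausdorffMeasure (finrank ℝ X)
  have : μ.IsAddHaarMeasure := isAddHaarMeasure_hausdorffMeasure
  let w : X → ℝ := fun x => max 0 (1 - ‖x‖)
  have hw : Continuous w := by fun_prop
  have hwc : HasCompactSupport w := by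
    refine HasCompactSupport.of_support_subset_isCompact (isCompact_closedBall 0 1) fun x hx => ?_
    by_contra h
    refine hx (max_eq_left ?_)
    simp at h
    linarith
  have hint (f : Dual ℝ X) : Integrable (fun x => w x • f x • x) μ := by
    have := f.continuous_of_finiteDimensional
    exact Continuous.integrable_of_hasCompactSupport (by fun_prop) hwc.smul_right
  let J : Dual ℝ X →ₗ[ℝ] X :=
    { toFun := fun f => ∫ x, w x • f x • x ∂μ
      map_add' := fun f g => by
        rw [← integral_add (hint f) (hint g)]
        simp only [LinearMap.add_apply, add_smul, smul_add]
      map_smul' := fun c f => by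
        rw [RingHom.id_apply, ← integral_smul]
        congr with x
        simp only [LinearMap.smul_apply, smul_eq_mul, smul_smul]
        congr 1
        ring }
  have J_apply (f : Dual ℝ X) : J f = ∫ x, w x • f x • x ∂μ := rfl
  have J_pos (f : Dual ℝ X) (hf : f ≠ 0) : 0 < f (J f) := by
    have hfc := f.continuous_of_finiteDimensional
    have h1 : f (J f) = ∫ x, w x * (f x * f x) ∂μ := by
      have := (LinearMap.toContinuousLinearMap f).integral_comp_comm (hint f)
      simpa [J_apply] using this.symm
    obtain ⟨x, hx⟩ : ∃ x, f x ≠ 0 := by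
      by_contra! h
      exact hf (LinearMap.ext h)
    have hx0 : x ≠ 0 := by rintro rfl; simp at hx
    have hxn : 0 < ‖x‖ := by simpa using hx0
    rw [h1]
    refine Continuous.integral_pos_of_hasCompactSupport_nonneg_nonzero
      (x := (2 * ‖x‖)⁻¹ • x) (by fun_prop) hwc.mul_right
      (fun y => mul_nonneg (le_max_left _ _) (mul_self_nonneg _)) ?_
    have hwx : w ((2 * ‖x‖)⁻¹ • x) = 1 / 2 := by
      have : ‖(2 * ‖x‖)⁻¹ • x‖ = 1 / 2 := by
        rw [norm_smul, Real.norm_of_nonneg (by positivity)]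
        field_simp
      simp only [w, this]
      norm_num
    rw [hwx]
    simp [hx, hx0]
  have J_inj : Function.Injective J := by
    refine (injective_iff_map_eq_zero J).mpr fun f hf => ?_
    by_contra h
    simpa [hf] using J_pos f h
  let e : Dual ℝ X ≃ₗ[ℝ] X := J.linearEquivOfInjective J_inj Subspace.dual_finrank_eq
  have e_apply (f : Dual ℝ X) : e f = J f := rfl
  refine ⟨e.symm.toLinearMap, fun x hx => ?_, fun T x => ?_⟩
  · have := J_pos (e.symm x) (by simpa using hx)
    rwa [← e_apply, e.apply_symm_apply] at this
  · have h : e (e.symm x ∘ₗ T.symm.toLinearEquiv.toLinearMap) = T x := by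
      rw [e_apply, J_apply,
        ← (T.toIsometryEquiv.measurePreserving_hausdorffMeasure _).integral_comp
          T.toHomeomorph.measurableEmbedding]
      have := (T : X →L[ℝ] X).integral_comp_comm (hint (e.symm x))
      rw [← J_apply, ← e_apply, e.apply_symm_apply] at this
      simpa [w] using this
    have h' : e.symm (T x) = e.symm x ∘ₗ T.symm.toLinearEquiv.toLinearMap := by
      rw [← h, e.symm_apply_apply]
    simp [h']

theorem NormAttainmentIsSubspace.innerProductSpaceable (hX : NormAttainmentIsSubspace X) :
    InnerProductSpaceable X := by
  obtain ⟨b, hpos, hinv⟩ := exists_pos_bilin_isometry_invariant (X := X)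
  have hsphere {x y : X} (hx : ‖x‖ = 1) (hy : ‖y‖ = 1) : b x x = b y y := by
    have main (g : X →L[ℝ] ℝ) (hg : ‖g‖ = 1) (hgx : 0 ≤ g x) (z : X) (hz : ‖z‖ = 1)
        (hgz : g z = 1) : b x x = b z z := by
      obtain ⟨T, hT, hTx⟩ := hX.exists_isometry_apply_eq_one hx hg hgx
      have h := hX.eq_of_apply_eq_one hg ((hT x).trans hx) hz hTx hgz
      let U : X ≃ₗᵢ[ℝ] X :=
        LinearIsometry.toLinearIsometryEquiv ⟨(T : X →ₗ[ℝ] X), hT⟩ rfl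
      have hU : U x = z := h
      rw [← hU, hinv]
    obtain ⟨g, hg, hgy⟩ := exists_dual_vector ℝ y (by simp [hy])
    have hgy1 : g y = 1 := by simpa [hy] using hgy
    rcases le_total 0 (g x) with h | h
    · exact main g hg h y hy hgy1
    · simpa using main (-g) (by simpa using hg) (by simpa using h) (-y) (by simpa using hy)
        (by simpa using hgy1)
  rcases subsingleton_or_nontrivial X with hs | hn
  · exact ⟨fun x y => by simp [Subsingleton.elim x 0, Subsingleton.elim y 0]⟩
  obtain ⟨u, hu⟩ := exists_norm_eq X zero_le_one
  have hu0 : u ≠ 0 := by rintro rfl; simp at hu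
  have hc := hpos u hu0
  have hb (x : X) : b x x = b u u * (‖x‖ * ‖x‖) := by
    rcases eq_or_ne x 0 with rfl | hx
    · simp
    have h := hsphere (norm_smul_inv_norm (𝕜 := ℝ) hx) hu
    have hxn : ‖x‖ ≠ 0 := by simpa using hx
    simp at h
    field_simp at h
    linarith
  refine ⟨fun x y => mul_left_cancel₀ hc.ne' ?_⟩
  have h1 : b (x + y) (x + y) + b (x - y) (x - y) = 2 * (b x x + b y y) := by
    simp only [map_add, map_sub, LinearMap.add_apply, LinearMap.sub_apply]
    ring
  rw [hb (x + y), hb (x - y), hb x, hb y] at h1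
  linarith

end FiniteDimensional

/-- A finite-dimensional real normed space is a Hilbert space (its norm comes from an
inner product) iff for every linear operator `T` the norm attainment set `M_T` is the
unit sphere of some subspace. -/
theorem stmt_9 {X : Type*} [NormedAddCommGroup X] [NormedSpace ℝ X]
    [FiniteDimensional ℝ X] :
    Nonempty (InnerProductSpace ℝ X) ↔
      ∀ T : X →L[ℝ] X, ∃ V : Submodule ℝ X,
        {x : X | ‖x‖ = 1 ∧ ‖T x‖ = ‖T‖} = {x : X | x ∈ V ∧ ‖x‖ = 1} := by
  constructor
  · rintro ⟨hH⟩
    have : InnerProductSpaceable X := ⟨@parallelogram_law_with_norm_mul ℝ X _ _ hH⟩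
    exact InnerProductSpaceable.normAttainmentIsSubspace
  · intro hX
    have := NormAttainmentIsSubspace.innerProductSpaceable hX
    exact nonempty_innerProductSpace ℝ X
end

section
/- Let X be an n-dimensional real polyhedral normed space, i.e., the closed unit ball B_X is the convex hull of a finite set of points, and let Y be a real normed space. If T : X → Y is a linear operator that is an extreme point of the closed unit ball of the space L(X, Y) of linear operators with the operator norm (an extreme contraction), then the norm attainment set M_T = { x ∈ X : ‖x‖ = 1, ‖Tx‖ = ‖T‖ } contains n linearly independent extreme points of B_X. -/
open Set Filter Topology Metric

/-- A nonzero extreme point of the closed unit ball has norm one. -/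
theorem norm_eq_one_of_mem_extremePoints_closedBall {X : Type*} [NormedAddCommGroup X]
    [NormedSpace ℝ X] {v : X} (hv : v ∈ extremePoints ℝ (closedBall (0 : X) 1)) (h0 : v ≠ 0) :
    ‖v‖ = 1 := by
  have hle : ‖v‖ ≤ 1 := by simpa using hv.1
  by_contra hne
  have hlt : ‖v‖ < 1 := lt_of_le_of_ne hle hne
  have hpos : 0 < ‖v‖ := norm_pos_iff.2 h0
  have hunit : ‖v‖⁻¹ • v ∈ closedBall (0 : X) 1 := by
    simp [norm_smul, hpos.ne']
  have hseg : v ∈ openSegment ℝ (0 : X) (‖v‖⁻¹ • v) :=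
    ⟨1 - ‖v‖, ‖v‖, by linarith, hpos, by ring, by simp [smul_smul, hpos.ne']⟩
  exact h0 (hv.2 (by simp) hunit hseg).symm

/-- On a finite-dimensional space, an operator bounded by one on the extreme points of the closed
unit ball is a contraction. -/
theorem opNorm_le_one_of_forall_extremePoints {X Y : Type*} [NormedAddCommGroup X]
    [NormedSpace ℝ X] [NormedAddCommGroup Y] [NormedSpace ℝ Y] [FiniteDimensional ℝ X]
    (A : X →L[ℝ] Y) (hA : ∀ v ∈ extremePoints ℝ (closedBall (0 : X) 1), ‖A v‖ ≤ 1) :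
    ‖A‖ ≤ 1 := by
  have : ProperSpace X := FiniteDimensional.proper ℝ X
  have hconv : Convex ℝ (A ⁻¹' closedBall (0 : Y) 1) :=
    (convex_closedBall (0 : Y) 1).linear_preimage (A : X →ₗ[ℝ] Y)
  have hclosed : IsClosed (A ⁻¹' closedBall (0 : Y) 1) := isClosed_closedBall.preimage A.continuous
  have hsub : closedBall (0 : X) 1 ⊆ A ⁻¹' closedBall (0 : Y) 1 := by
    rw [← closure_convexHull_extremePoints (isCompact_closedBall (0 : X) 1)
      (convex_closedBall (0 : X) 1)]
    exact closure_minimal (convexHull_min (fun v hv => by simpa using hA v hv) hconv) hclosed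
  refine A.opNorm_le_of_unit_norm zero_le_one fun x hx => ?_
  simpa using hsub (show x ∈ closedBall (0 : X) 1 by simp [hx])

/-- If `T` is an extreme contraction on a polyhedral space, an operator vanishing at the extreme
points of the unit ball at which `T` attains its norm is zero. -/
theorem eq_zero_of_forall_extremePoints_norm_attained {X Y : Type*} [NormedAddCommGroup X]
    [NormedSpace ℝ X] [NormedAddCommGroup Y] [NormedSpace ℝ Y] [FiniteDimensional ℝ X]
    (hfin : (extremePoints ℝ (closedBall (0 : X) 1)).Finite) {T : X →L[ℝ] Y}
    (hT : T ∈ extremePoints ℝ (closedBall (0 : X →L[ℝ] Y) 1)) (A : X →L[ℝ] Y)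
    (hA : ∀ v ∈ extremePoints ℝ (closedBall (0 : X) 1), ‖T v‖ = ‖T‖ → A v = 0) :
    A = 0 := by
  have hT1 : ‖T‖ ≤ 1 := by simpa using hT.1
  have hev : ∀ᶠ ε : ℝ in 𝓝 0,
      ∀ v ∈ extremePoints ℝ (closedBall (0 : X) 1), ‖(T + ε • A) v‖ ≤ 1 := by
    rw [hfin.eventually_all]
    intro v hv
    have hle : ‖T v‖ ≤ ‖T‖ := T.unit_le_opNorm v (by simpa using hv.1)
    by_cases h : ‖T v‖ = ‖T‖
    · simp [hA v hv h, h, hT1]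
    · have hcont : Continuous fun ε : ℝ => ‖(T + ε • A) v‖ := by
        simp only [add_apply, smul_apply]
        fun_prop
      have hlt : ‖(T + (0 : ℝ) • A) v‖ < 1 := by
        simpa using (lt_of_le_of_ne hle h).trans_le hT1
      exact (hcont.continuousAt.eventually_lt continuousAt_const hlt).mono fun _ => le_of_lt
  obtain ⟨δ, hδ, hball⟩ := Metric.eventually_nhds_iff.1 hev
  have hmem : ∀ ε : ℝ, |ε| < δ → T + ε • A ∈ closedBall (0 : X →L[ℝ] Y) 1 := fun ε hε => by
    simpa using opNorm_le_one_of_forall_extremePoints _ (hball (by simpa using hε))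
  have hδ2 : |δ / 2| < δ := by rw [abs_of_pos (half_pos hδ)]; linarith
  have hseg : T ∈ openSegment ℝ (T + (δ / 2) • A) (T + (-(δ / 2)) • A) :=
    ⟨1 / 2, 1 / 2, by norm_num, by norm_num, by norm_num, by module⟩
  have heq := hT.2 (hmem _ hδ2) (hmem _ (by rwa [abs_neg])) hseg
  exact (smul_eq_zero.1 (add_eq_left.1 heq)).resolve_left (half_pos hδ).ne'

/-- The extreme points of the unit ball of a polyhedral space at which an extreme contraction
attains its norm span the space. -/
theorem span_extremePoints_norm_attained_eq_top {X Y : Type*} [NormedAddCommGroup X]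
    [NormedSpace ℝ X] [NormedAddCommGroup Y] [NormedSpace ℝ Y] [FiniteDimensional ℝ X]
    (hfin : (extremePoints ℝ (closedBall (0 : X) 1)).Finite) {T : X →L[ℝ] Y}
    (hT : T ∈ extremePoints ℝ (closedBall (0 : X →L[ℝ] Y) 1)) :
    Submodule.span ℝ {v ∈ extremePoints ℝ (closedBall (0 : X) 1) | ‖T v‖ = ‖T‖} = ⊤ := by
  by_contra hne
  obtain ⟨f, hf0, hf⟩ := Submodule.exists_le_ker_of_lt_top _ (lt_top_iff_ne_top.2 hne)
  have hfv : ∀ v ∈ extremePoints ℝ (closedBall (0 : X) 1), ‖T v‖ = ‖T‖ → f v = 0 :=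
    fun v hv hTv => hf (Submodule.subset_span ⟨hv, hTv⟩)
  obtain ⟨x, hx⟩ : ∃ x, f x ≠ 0 := by
    by_contra! h
    exact hf0 (LinearMap.ext h)
  obtain hY | hY := subsingleton_or_nontrivial Y
  · have hT0 : T = 0 := Subsingleton.elim _ _
    have hle : ∀ c : ℝ, ‖c • f.toContinuousLinearMap‖ ≤ 1 := fun c =>
      opNorm_le_one_of_forall_extremePoints _ fun v hv => by
        simp [hfv v hv (by simp [hT0])]
    have hg : ‖f.toContinuousLinearMap‖ ≠ 0 := by
      rw [norm_ne_zero_iff]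
      exact fun h => hx (by simpa using DFunLike.congr_fun h x)
    have h2 := hle (2 * ‖f.toContinuousLinearMap‖⁻¹)
    rw [norm_smul, norm_mul, norm_inv, norm_norm, mul_assoc, inv_mul_cancel₀ hg] at h2
    norm_num at h2
  · obtain ⟨y, hy⟩ := exists_ne (0 : Y)
    have hzero := eq_zero_of_forall_extremePoints_norm_attained hfin hT
      (f.toContinuousLinearMap.smulRight y) fun v hv hTv => by simp [hfv v hv hTv]
    have hxy : f x • y = 0 := by simpa using DFunLike.congr_fun hzero x
    exact (smul_ne_zero hx hy) hxy

/-- If `X` is an `n`-dimensional real polyhedral normed space and `T : X → Y` is an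
extreme contraction, then the norm attainment set of `T` contains `n` linearly
independent extreme points of the closed unit ball of `X`. -/
theorem stmt_10 {X Y : Type*} [NormedAddCommGroup X] [NormedSpace ℝ X]
    [NormedAddCommGroup Y] [NormedSpace ℝ Y] [FiniteDimensional ℝ X] (n : ℕ)
    (hdim : Module.finrank ℝ X = n)
    (hpoly : ∃ F : Finset X, (Metric.closedBall (0 : X) 1 : Set X) = convexHull ℝ (F : Set X))
    (T : X →L[ℝ] Y)
    (hT : T ∈ Set.extremePoints ℝ (Metric.closedBall (0 : X →L[ℝ] Y) 1)) :
    ∃ v : Fin n → X, LinearIndependent ℝ v ∧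
      ∀ i, v i ∈ Set.extremePoints ℝ (Metric.closedBall (0 : X) 1) ∧
        ‖v i‖ = 1 ∧ ‖T (v i)‖ = ‖T‖ := by
  obtain ⟨F, hF⟩ := hpoly
  have hfin : (extremePoints ℝ (closedBall (0 : X) 1)).Finite := by
    rw [hF]
    exact F.finite_toSet.subset extremePoints_convexHull_subset
  have hspan := span_extremePoints_norm_attained_eq_top hfin hT
  obtain ⟨v, hv, -, hli⟩ := Submodule.exists_fun_fin_finrank_span_eq ℝ
    {v ∈ extremePoints ℝ (closedBall (0 : X) 1) | ‖T v‖ = ‖T‖}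
  have hrank : n = Module.finrank ℝ
      (Submodule.span ℝ {v ∈ extremePoints ℝ (closedBall (0 : X) 1) | ‖T v‖ = ‖T‖}) := by
    rw [hspan, finrank_top, hdim]
  refine ⟨v ∘ Fin.cast hrank, hli.comp _ (Fin.cast_injective hrank), fun i => ?_⟩
  have hi := hv (Fin.cast hrank i)
  exact ⟨hi.1, norm_eq_one_of_mem_extremePoints_closedBall hi.1 (hli.ne_zero _), hi.2⟩
end

section
/- Let H be a complex Hilbert space. The set of minimum attaining bounded linear operators on H, i.e., operators T ∈ B(H) for which there exists x ∈ H with ‖x‖ = 1 and ‖Tx‖ = m(T), where m(T) = inf { ‖Ty‖ : y ∈ H, ‖y‖ = 1 }, is dense in B(H) with respect to the operator norm. -/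
open scoped InnerProductSpace

/-- If `T` is bounded below by `m` and `x` is a unit vector with `‖T x‖` close to `m`, then `T`
almost preserves orthogonality to `x`. -/
theorem norm_inner_map_sq_le_of_orthogonal {H : Type*} [NormedAddCommGroup H]
    [InnerProductSpace ℂ H] {T : H →L[ℂ] H} {m : ℝ} (hm : 0 ≤ m) (hT : ∀ y, m * ‖y‖ ≤ ‖T y‖)
    {x z : H} (hx : ‖x‖ = 1) (hxz : ⟪x, z⟫_ℂ = 0) :
    ‖⟪T x, T z⟫_ℂ‖ ^ 2 ≤ (‖T x‖ ^ 2 - m ^ 2) * ‖T z‖ ^ 2 := by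
  by_cases hz : T z = 0
  · simp [hz]
  have hpos : 0 < ‖T z‖ := norm_pos_iff.2 hz
  have hne : (‖T z‖ : ℂ) ≠ 0 := by exact_mod_cast hpos.ne'
  set a : ℂ := ⟪T z, T x⟫_ℂ / (‖T z‖ : ℂ) ^ 2 with ha
  have horth : ⟪T x - a • T z, a • T z⟫_ℂ = 0 := by
    rw [← inner_conj_symm, inner_smul_left, inner_sub_right, inner_smul_right,
      inner_self_eq_norm_sq_to_K]
    have : a * (‖T z‖ : ℂ) ^ 2 = ⟪T z, T x⟫_ℂ := by rw [ha]; field_simp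
    simp [this]
  have hpyth := norm_add_sq_eq_norm_sq_add_norm_sq_of_inner_eq_zero _ _ horth
  have hlow : m ≤ ‖T x - a • T z‖ := by
    have h1 : 1 ≤ ‖x - a • z‖ := by
      have h := norm_inner_le_norm (𝕜 := ℂ) x (x - a • z)
      rw [inner_sub_right, inner_smul_right, hxz, inner_self_eq_norm_sq_to_K] at h
      simpa [hx] using h
    calc m ≤ m * ‖x - a • z‖ := le_mul_of_one_le_right hm h1
      _ ≤ _ := by simpa using hT (x - a • z)
  have hnorm : ‖a • T z‖ * ‖T z‖ = ‖⟪T x, T z⟫_ℂ‖ := by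
    rw [norm_smul, ha, norm_div, norm_inner_symm (T z)]
    simp only [norm_pow, Complex.norm_real, norm_norm]
    field_simp
  rw [sub_add_cancel] at hpyth
  rw [← hnorm, mul_pow]
  gcongr
  nlinarith

/-- An operator mapping the unit vector `x` to `s • u` and `xᗮ` into `uᗮ`, bounded below by `s` on
`xᗮ`, is bounded below by `s`. -/
theorem mul_norm_le_norm_add_smul {H : Type*} [NormedAddCommGroup H]
    [InnerProductSpace ℂ H] {s : ℝ} (hs : 0 ≤ s) {x u z w : H} (hx : ‖x‖ = 1) (hu : ‖u‖ = 1)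
    (hxz : ⟪x, z⟫_ℂ = 0) (huw : ⟪u, w⟫_ℂ = 0) (hzw : s * ‖z‖ ≤ ‖w‖) (c : ℂ) :
    s * ‖z + c • x‖ ≤ ‖w + ((s : ℂ) * c) • u‖ := by
  have h1 : ‖z + c • x‖ ^ 2 = ‖z‖ ^ 2 + ‖c‖ ^ 2 := by
    have h := norm_add_sq_eq_norm_sq_add_norm_sq_of_inner_eq_zero (𝕜 := ℂ) z (c • x)
      (by rw [inner_smul_right, inner_eq_zero_symm.1 hxz, mul_zero])
    rw [norm_smul, hx] at h
    linarith
  have h2 : ‖w + ((s : ℂ) * c) • u‖ ^ 2 = ‖w‖ ^ 2 + s ^ 2 * ‖c‖ ^ 2 := by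
    have h := norm_add_sq_eq_norm_sq_add_norm_sq_of_inner_eq_zero (𝕜 := ℂ) w (((s : ℂ) * c) • u)
      (by rw [inner_smul_right, inner_eq_zero_symm.1 huw, mul_zero])
    rw [norm_smul, hu, norm_mul, Complex.norm_real, Real.norm_of_nonneg hs] at h
    linarith
  refine le_of_sq_le_sq ?_ (norm_nonneg _)
  rw [mul_pow, h1, h2, mul_add, ← mul_pow]
  gcongr

/-- A bounded-below operator `T` which almost attains its lower bound at `x` is close to an
operator attaining its lower bound at `x`. -/
theorem exists_lowerBound_attained_near {H : Type*} [NormedAddCommGroup H]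
    [InnerProductSpace ℂ H] {T : H →L[ℂ] H} {m η : ℝ} (hη : 0 < η) (hηm : η < m)
    (hT : ∀ y, m * ‖y‖ ≤ ‖T y‖) {x : H} (hx : ‖x‖ = 1)
    (hTx : ‖T x‖ < m + η) (hTx' : (‖T x‖ ^ 2 - m ^ 2) * ‖T‖ ^ 2 ≤ (η * m) ^ 2) :
    ∃ S : H →L[ℂ] H, ‖T - S‖ ≤ 3 * η ∧ ∀ y, ‖S x‖ * ‖y‖ ≤ ‖S y‖ := by
  have hm : 0 < m := hη.trans hηm
  have hmx : m ≤ ‖T x‖ := by simpa [hx] using hT x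
  have hTx0 : 0 < ‖T x‖ := hm.trans_le hmx
  have hTxc : (‖T x‖ : ℂ) ≠ 0 := by exact_mod_cast hTx0.ne'
  set u : H := (‖T x‖ : ℂ)⁻¹ • T x with hu_def
  have hu : ‖u‖ = 1 := by
    rw [hu_def, norm_smul]
    simp [hTx0.ne']
  have hxx : ⟪x, x⟫_ℂ = 1 := by simp [inner_self_eq_norm_sq_to_K, hx]
  have huu : ⟪u, u⟫_ℂ = 1 := by simp [inner_self_eq_norm_sq_to_K, hu]
  have hTxu : T x = (‖T x‖ : ℂ) • u := by rw [hu_def, smul_smul, mul_inv_cancel₀ hTxc, one_smul]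
  have hsmall : ∀ z, ⟪x, z⟫_ℂ = 0 → ‖⟪u, T z⟫_ℂ‖ ≤ η * ‖z‖ := by
    intro z hz
    have h := norm_inner_map_sq_le_of_orthogonal hm.le hT hx hz
    have h1 : ‖⟪T x, T z⟫_ℂ‖ ≤ η * m * ‖z‖ := by
      refine le_of_sq_le_sq ?_ (by positivity)
      calc _ ≤ _ := h
        _ ≤ (‖T x‖ ^ 2 - m ^ 2) * (‖T‖ * ‖z‖) ^ 2 := by
          have : 0 ≤ ‖T x‖ ^ 2 - m ^ 2 := by nlinarith
          gcongr
          exact T.le_opNorm z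
        _ = (‖T x‖ ^ 2 - m ^ 2) * ‖T‖ ^ 2 * ‖z‖ ^ 2 := by ring
        _ ≤ (η * m) ^ 2 * ‖z‖ ^ 2 := by gcongr
        _ = _ := by ring
    have h2 : ‖T x‖ * ‖⟪u, T z⟫_ℂ‖ = ‖⟪T x, T z⟫_ℂ‖ := by
      conv_rhs => rw [hTxu, inner_smul_left]
      simp
    refine le_of_mul_le_mul_left ?_ hm
    calc m * ‖⟪u, T z⟫_ℂ‖ ≤ ‖T x‖ * ‖⟪u, T z⟫_ℂ‖ := by gcongr
      _ ≤ m * (η * ‖z‖) := by rw [h2]; linarith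
  let Q : H →L[ℂ] H := ContinuousLinearMap.id ℂ H - (innerSL ℂ x).smulRight x
  have hQ : ∀ y, Q y = y - ⟪x, y⟫_ℂ • x := fun y => by simp [Q]
  have hxQ : ∀ y, ⟪x, Q y⟫_ℂ = 0 := fun y => by
    rw [hQ, inner_sub_right, inner_smul_right, hxx, mul_one, sub_self]
  have hQn : ∀ y, ‖Q y‖ ≤ ‖y‖ := fun y => by
    have h := norm_add_sq_eq_norm_sq_add_norm_sq_of_inner_eq_zero (𝕜 := ℂ) (Q y)
      (⟪x, y⟫_ℂ • x) (by rw [inner_smul_right, inner_eq_zero_symm.1 (hxQ y), mul_zero])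
    rw [hQ, sub_add_cancel, ← hQ] at h
    nlinarith [norm_nonneg y, norm_nonneg (Q y), norm_nonneg (⟪x, y⟫_ℂ • x)]
  let D : H →L[ℂ] H := ((innerSL ℂ u).comp (T.comp Q) +
    ((‖T x‖ - (m - η) : ℝ) : ℂ) • innerSL ℂ x).smulRight u
  have hD : ∀ y, D y = (⟪u, T (Q y)⟫_ℂ + ((‖T x‖ - (m - η) : ℝ) : ℂ) * ⟪x, y⟫_ℂ) • u :=
    fun y => by simp [D]
  have hS : ∀ y, (T - D) y =
      (T (Q y) - ⟪u, T (Q y)⟫_ℂ • u) + (((m - η : ℝ) : ℂ) * ⟪x, y⟫_ℂ) • u := by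
    intro y
    have hTy : T y = T (Q y) + (⟪x, y⟫_ℂ * ‖T x‖) • u := by
      rw [mul_smul, ← hTxu, ← map_smul, ← map_add, hQ, sub_add_cancel]
    rw [sub_apply, hD, hTy]
    push_cast
    module
  have hSx : ‖(T - D) x‖ = m - η := by
    rw [hS, hQ, hxx]
    simp [norm_smul, hu, abs_of_pos (sub_pos.2 hηm), -Complex.ofReal_sub]
  refine ⟨T - D, ?_, fun y => ?_⟩
  · rw [sub_sub_cancel]
    refine ContinuousLinearMap.opNorm_le_bound _ (by positivity) fun y => ?_
    have h1 : ‖⟪u, T (Q y)⟫_ℂ‖ ≤ η * ‖y‖ := (hsmall _ (hxQ y)).trans (by gcongr; exact hQn y)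
    have h2 : ‖⟪x, y⟫_ℂ‖ ≤ ‖y‖ := by simpa [hx] using norm_inner_le_norm (𝕜 := ℂ) x y
    have h3 : (0 : ℝ) ≤ ‖T x‖ - (m - η) := by linarith
    rw [hD, norm_smul, hu, mul_one]
    calc _ ≤ ‖⟪u, T (Q y)⟫_ℂ‖ + (‖T x‖ - (m - η)) * ‖⟪x, y⟫_ℂ‖ := by
          refine (norm_add_le _ _).trans_eq ?_
          rw [norm_mul, Complex.norm_real, Real.norm_of_nonneg h3]
      _ ≤ η * ‖y‖ + (2 * η) * ‖y‖ := by
          gcongr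
          linarith
      _ = _ := by ring
  · have hw : (m - η) * ‖Q y‖ ≤ ‖T (Q y) - ⟪u, T (Q y)⟫_ℂ • u‖ := by
      have h1 := norm_sub_norm_le (T (Q y)) (⟪u, T (Q y)⟫_ℂ • u)
      rw [norm_smul, hu, mul_one] at h1
      linarith [hT (Q y), hsmall _ (hxQ y)]
    have h := mul_norm_le_norm_add_smul (sub_pos.2 hηm).le hx hu (hxQ y)
      (by rw [inner_sub_right, inner_smul_right, huu, mul_one, sub_self]) hw ⟪x, y⟫_ℂ
    rw [hSx, hS]
    rwa [hQ, sub_add_cancel, ← hQ] at h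

/-- An operator is minimum attaining at a unit vector `x` as soon as it is bounded below by
`‖S x‖`. -/
theorem norm_map_eq_sInf_of_forall_le {H : Type*} [NormedAddCommGroup H]
    [InnerProductSpace ℂ H] {S : H →L[ℂ] H} {x : H} (hx : ‖x‖ = 1)
    (hS : ∀ y, ‖S x‖ * ‖y‖ ≤ ‖S y‖) :
    ‖S x‖ = sInf {r : ℝ | ∃ y : H, ‖y‖ = 1 ∧ r = ‖S y‖} := by
  refine Eq.symm (IsLeast.csInf_eq ?_)
  refine ⟨⟨x, hx, rfl⟩, ?_⟩
  rintro _ ⟨y, hy, rfl⟩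
  simpa [hy] using hS y

/-- The set of minimum attaining bounded operators on a complex Hilbert space is dense
in `B(H)` with the operator norm. -/
theorem stmt_11 {H : Type*} [NormedAddCommGroup H] [InnerProductSpace ℂ H]
    [CompleteSpace H] [Nontrivial H] :
    Dense {T : H →L[ℂ] H | ∃ x : H, ‖x‖ = 1 ∧
      ‖T x‖ = sInf {r : ℝ | ∃ y : H, ‖y‖ = 1 ∧ r = ‖T y‖}} := by
  rw [Metric.dense_iff]
  intro T ε hε
  suffices h : ∃ S : H →L[ℂ] H, ‖T - S‖ < ε ∧ ∃ x, ‖x‖ = 1 ∧ ∀ y, ‖S x‖ * ‖y‖ ≤ ‖S y‖ by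
    obtain ⟨S, hTS, x, hx, hS⟩ := h
    exact ⟨S, by rwa [Metric.mem_ball, dist_comm, dist_eq_norm], x, hx,
      norm_map_eq_sInf_of_forall_le hx hS⟩
  set M : Set ℝ := {r : ℝ | ∃ y : H, ‖y‖ = 1 ∧ r = ‖T y‖}
  have hne : M.Nonempty := by
    obtain ⟨x, hx⟩ := exists_norm_eq H zero_le_one
    exact ⟨_, x, hx, rfl⟩
  have hbdd : BddBelow M := ⟨0, by rintro _ ⟨y, -, rfl⟩; exact norm_nonneg _⟩
  set m := sInf M
  have hm0 : 0 ≤ m := le_csInf hne (by rintro _ ⟨y, -, rfl⟩; exact norm_nonneg _)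
  have hnear : ∀ b, m < b → ∃ x, ‖x‖ = 1 ∧ ‖T x‖ < b := by
    intro b hb
    obtain ⟨_, ⟨x, hx, rfl⟩, h⟩ := exists_lt_of_csInf_lt hne hb
    exact ⟨x, hx, h⟩
  rcases hm0.eq_or_lt with hm | hm
  · obtain ⟨x, hx, hTx⟩ := hnear ε (hm ▸ hε)
    refine ⟨T - (innerSL ℂ x).smulRight (T x), ?_, x, hx, fun y => ?_⟩
    · rwa [sub_sub_cancel, ContinuousLinearMap.norm_smulRight_apply, innerSL_apply_norm, hx,
        one_mul]
    · simp [inner_self_eq_norm_sq_to_K, hx]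
  · have hT : ∀ y, m * ‖y‖ ≤ ‖T y‖ := by
      intro y
      rcases eq_or_ne y 0 with rfl | hy
      · simp
      have hy' : 0 < ‖y‖ := norm_pos_iff.2 hy
      have h : m ≤ ‖T ((‖y‖ : ℂ)⁻¹ • y)‖ :=
        csInf_le hbdd ⟨_, by rw [norm_smul]; simp [hy'.ne'], rfl⟩
      rw [map_smul, norm_smul, norm_inv, Complex.norm_real, norm_norm, ← div_eq_inv_mul,
        le_div_iff₀ hy'] at h
      exact h
    obtain ⟨η, hη, hη'⟩ := exists_between (lt_min hm (by positivity : 0 < ε / 3))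
    obtain ⟨hηm, hηε⟩ := lt_min_iff.1 hη'
    have hgap : 0 < (η * m) ^ 2 / (‖T‖ ^ 2 + 1) := by positivity
    obtain ⟨x, hx, hTx⟩ := hnear (min (m + η) √(m ^ 2 + (η * m) ^ 2 / (‖T‖ ^ 2 + 1)))
      (lt_min (by linarith) (Real.lt_sqrt_of_sq_lt (by linarith)))
    obtain ⟨hTx1, hTx2⟩ := lt_min_iff.1 hTx
    have hTx3 : ‖T x‖ ^ 2 - m ^ 2 ≤ (η * m) ^ 2 / (‖T‖ ^ 2 + 1) := by
      have := (Real.lt_sqrt (norm_nonneg _)).1 hTx2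
      linarith
    obtain ⟨S, hTS, hS⟩ := exists_lowerBound_attained_near hη hηm hT hx hTx1 (by
      calc _ ≤ (η * m) ^ 2 / (‖T‖ ^ 2 + 1) * (‖T‖ ^ 2 + 1) := by
            gcongr
            linarith
        _ = _ := div_mul_cancel₀ _ (by positivity))
    exact ⟨S, by linarith, x, hx, hS⟩
end

section
/- For every integer n ≥ 2 and every k ∈ ℕ, there is no ℂ-linear isometric embedding of ℓ₁ⁿ(ℂ) = (ℂⁿ, ‖·‖₁) into the space M_k(ℂ) of k × k complex matrices equipped with the operator norm; that is, there is no ℂ-linear map φ : ℂⁿ → M_k(ℂ) with ‖φ(x)‖_op = ‖x‖₁ for all x ∈ ℂⁿ. -/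
open Metric in
/-- A continuous linear map on a finite-dimensional complex space attains its norm on the
closed unit ball. -/
theorem ContinuousLinearMap.exists_norm_le_one_norm_apply_eq {E F : Type*}
    [NormedAddCommGroup E] [NormedSpace ℂ E] [FiniteDimensional ℂ E]
    [NormedAddCommGroup F] [NormedSpace ℂ F] (T : E →L[ℂ] F) :
    ∃ x, ‖x‖ ≤ 1 ∧ ‖T x‖ = ‖T‖ := by
  have : ProperSpace E := FiniteDimensional.proper ℂ E
  obtain ⟨x, hx, h⟩ := (isCompact_closedBall (0 : E) 1).exists_sSup_image_eq
    ⟨0, by simp⟩ (f := fun x => ‖T x‖) (by fun_prop)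
  exact ⟨x, by simpa using hx, by rw [← h, T.sSup_unitClosedBall_eq_norm]⟩

/-- Two vectors of norm at most one whose sum has norm two coincide. -/
theorem eq_of_norm_le_one_of_norm_add_eq_two {E : Type*} [NormedAddCommGroup E]
    [InnerProductSpace ℂ E] {u v : E} (hu : ‖u‖ ≤ 1) (hv : ‖v‖ ≤ 1) (h : ‖u + v‖ = 2) :
    u = v := by
  have hp := parallelogram_law_with_norm ℂ u v
  rw [h] at hp
  have h0 : ‖u - v‖ = 0 := by
    nlinarith [norm_nonneg u, norm_nonneg v, norm_nonneg (u - v)]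
  exact sub_eq_zero.mp (norm_eq_zero.mp h0)

open ContinuousLinearMap in
/-- If `B` is a contraction and `x` is a vector in the closed unit ball with `1 ≤ ‖B x‖`, then
`B† B` fixes `x`. -/
theorem ContinuousLinearMap.adjoint_apply_apply_eq_self {E : Type*} [NormedAddCommGroup E]
    [InnerProductSpace ℂ E] [CompleteSpace E] {B : E →L[ℂ] E} (hB : ‖B‖ ≤ 1) {x : E}
    (hx : ‖x‖ ≤ 1) (hBx : 1 ≤ ‖B x‖) : adjoint B (B x) = x := by
  have h1 : ‖B x‖ ≤ 1 := by simpa using B.le_of_opNorm_le_of_le hB hx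
  have h2 : ‖adjoint B (B x)‖ ≤ 1 := by
    simpa using (adjoint B).le_of_opNorm_le_of_le ((adjoint.norm_map B).trans_le hB) h1
  have h3 := norm_sub_sq (𝕜 := ℂ) (adjoint B (B x)) x
  rw [adjoint_inner_left, inner_self_eq_norm_sq] at h3
  have h0 : ‖adjoint B (B x) - x‖ = 0 := by
    nlinarith [norm_nonneg x, norm_nonneg (adjoint B (B x)), norm_nonneg (B x),
      norm_nonneg (adjoint B (B x) - x)]
  exact sub_eq_zero.mp (norm_eq_zero.mp h0)

open ContinuousLinearMap in
/-- If `A`, `B` are contractions with `‖A + z • B‖ = 2` for some unimodular `z`, then `z` is an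
eigenvalue of `B† A`. -/
theorem ContinuousLinearMap.hasEigenvalue_adjoint_comp {E : Type*} [NormedAddCommGroup E]
    [InnerProductSpace ℂ E] [FiniteDimensional ℂ E] [CompleteSpace E] {A B : E →L[ℂ] E}
    (hA : ‖A‖ ≤ 1) (hB : ‖B‖ ≤ 1) {z : ℂ} (hz : ‖z‖ = 1) (h : ‖A + z • B‖ = 2) :
    Module.End.HasEigenvalue ((adjoint B ∘L A : E →L[ℂ] E) : E →ₗ[ℂ] E) z := by
  obtain ⟨x, hx, hTx⟩ := (A + z • B).exists_norm_le_one_norm_apply_eq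
  have hAx : ‖A x‖ ≤ 1 := by simpa using A.le_of_opNorm_le_of_le hA hx
  have hBx : ‖B x‖ ≤ 1 := by simpa using B.le_of_opNorm_le_of_le hB hx
  have hzB : ‖z • B x‖ = ‖B x‖ := by rw [norm_smul, hz, one_mul]
  have hsum : ‖A x + z • B x‖ = 2 := by simpa [h] using hTx
  have hAB : A x = z • B x :=
    eq_of_norm_le_one_of_norm_add_eq_two hAx (hzB.trans_le hBx) hsum
  have one_le : 1 ≤ ‖B x‖ := by linarith [norm_add_le (A x) (z • B x)]
  refine Module.End.hasEigenvalue_of_hasEigenvector (x := x)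
    ⟨Module.End.mem_eigenspace_iff.mpr ?_, ?_⟩
  · simp [hAB, adjoint_apply_apply_eq_self hB hx one_le]
  · rintro rfl
    norm_num at one_le

/-- The unit circle in `ℂ` is infinite. -/
theorem Complex.infinite_sphere_zero_one : (Metric.sphere (0 : ℂ) 1).Infinite :=
  (isPreconnected_sphere (by simp [Complex.rank_real_complex]) 0 1).infinite_of_nontrivial
    ⟨1, by simp, -1, by simp, by norm_num⟩

/-- For `n ≥ 2` and any `k`, there is no `ℂ`-linear isometric embedding of `ℓ₁ⁿ(ℂ)` into
the `k × k` complex matrices (realized as operators on the Euclidean space `ℂᵏ`) with the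
operator norm. -/
theorem stmt_14 (n k : ℕ) (hn : 2 ≤ n) :
    ¬∃ φ : PiLp 1 (fun _ : Fin n => ℂ) →ₗ[ℂ]
        (EuclideanSpace ℂ (Fin k) →L[ℂ] EuclideanSpace ℂ (Fin k)),
      ∀ x, ‖φ x‖ = ‖x‖ := by
  rintro ⟨φ, hφ⟩
  let i : Fin n := ⟨0, by omega⟩
  let j : Fin n := ⟨1, by omega⟩
  have hij : i ≠ j := by simp [i, j]
  let e (l : Fin n) : PiLp 1 (fun _ : Fin n => ℂ) := PiLp.single 1 l (1 : ℂ)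
  have he (l : Fin n) : ‖φ (e l)‖ ≤ 1 := by rw [hφ]; simp [e]
  refine Complex.infinite_sphere_zero_one ((Module.End.finite_hasEigenvalue
    (ContinuousLinearMap.adjoint (φ (e j)) ∘L φ (e i)).toLinearMap).subset ?_)
  intro z hz
  have hz : ‖z‖ = 1 := by simpa using hz
  refine ContinuousLinearMap.hasEigenvalue_adjoint_comp (he i) (he j) hz ?_
  rw [← map_smul, ← map_add, hφ, PiLp.norm_eq_of_L1, Fintype.sum_eq_add i j hij]
  · simp [e, hij, hij.symm, hz]
    norm_num
  · rintro l ⟨hi, hj⟩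
    simp [e, hi, hj]
end

section
/- Let 𝒫 denote the set of real symmetric positive semidefinite 3 × 3 matrices. Then sup { Σ_{i,j=1}^3 A_{ij} B_{ij} : A, B ∈ 𝒫, max_{i,j} |A_{ij}| ≤ 1, sup_{‖x‖_∞ ≤ 1} ‖Bx‖₁ ≤ 1 } = 9/8; that is, the constant γ(ℓ₁ℝ(3)) equals 1.125. -/
/-- The off-diagonal pairing bound when all off-diagonal entries `-p, -q, -r` of `B` are
nonpositive and `p` is the smallest of the three in absolute value. -/
lemma trace_sub_pairing_le_of_min {p q r x y z T : ℝ} (hp : 0 ≤ p) (hpq : p ≤ q) (hpr : p ≤ r)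
    (hT : 2 * (p + q + r) ≤ T) (hB : T + 2 * (q + r - p) ≤ 1)
    (hA : 0 ≤ 3 + 2 * (x + y + z)) (hy : -1 ≤ y) (hz : -1 ≤ z) :
    T - 2 * (p * x + q * y + r * z) ≤ 9 / 8 := by
  nlinarith [mul_nonneg hp hA, mul_nonneg (sub_nonneg.2 hpq) (neg_le_iff_add_nonneg.1 hy),
    mul_nonneg (sub_nonneg.2 hpr) (neg_le_iff_add_nonneg.1 hz)]

/-- The off-diagonal pairing bound when all off-diagonal entries `-p, -q, -r` of `B` are
nonpositive. -/
lemma trace_sub_pairing_le {p q r x y z T : ℝ} (hp : 0 ≤ p) (hq : 0 ≤ q) (hr : 0 ≤ r)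
    (hT : 2 * (p + q + r) ≤ T) (hBp : T + 2 * (q + r - p) ≤ 1)
    (hBq : T + 2 * (p + r - q) ≤ 1) (hBr : T + 2 * (p + q - r) ≤ 1)
    (hA : 0 ≤ 3 + 2 * (x + y + z)) (hx : -1 ≤ x) (hy : -1 ≤ y) (hz : -1 ≤ z) :
    T - 2 * (p * x + q * y + r * z) ≤ 9 / 8 := by
  rcases le_total p q with hpq | hpq
  · rcases le_total p r with hpr | hpr
    · exact trace_sub_pairing_le_of_min hp hpq hpr hT hBp hA hy hz
    · linarith [trace_sub_pairing_le_of_min (x := z) (y := x) (z := y) (T := T) hr hpr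
        (hpr.trans hpq) (by linarith) (by linarith) (by linarith) hx hy]
  · rcases le_total q r with hqr | hqr
    · linarith [trace_sub_pairing_le_of_min (x := y) (y := x) (z := z) (T := T) hq hpq hqr
        (by linarith) (by linarith) (by linarith) hx hz]
    · linarith [trace_sub_pairing_le_of_min (x := z) (y := x) (z := y) (T := T) hr
        (hqr.trans hpq) hqr (by linarith) (by linarith) (by linarith) hx hy]

/-- The off-diagonal pairing bound when all off-diagonal entries of `B` are nonnegative. -/
lemma trace_add_pairing_le {p q r x y z T : ℝ} (hp : 0 ≤ p) (hq : 0 ≤ q) (hr : 0 ≤ r)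
    (hB : T + 2 * (p + q + r) ≤ 1) (hx : x ≤ 1) (hy : y ≤ 1) (hz : z ≤ 1) :
    T + 2 * (p * x + q * y + r * z) ≤ 9 / 8 := by
  nlinarith [mul_le_of_le_one_right hp hx, mul_le_of_le_one_right hq hy,
    mul_le_of_le_one_right hr hz]

/-- The pairing bound in terms of the entries: `x, y, z` are the off-diagonal entries of `A`,
`p, q, r` those of `B`, and `T` is the trace of `B`; the hypotheses evaluate the quadratic
forms of `A` and `B` at the four sign vectors (up to a global sign). -/
lemma trace_add_pairing_le_of_sign_vectors {p q r x y z T : ℝ}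
    (hx : |x| ≤ 1) (hy : |y| ≤ 1) (hz : |z| ≤ 1)
    (hA₁ : 0 ≤ 3 + 2 * (x + y + z)) (hA₂ : 0 ≤ 3 + 2 * (x - y - z))
    (hA₃ : 0 ≤ 3 + 2 * (-x + y - z)) (hA₄ : 0 ≤ 3 + 2 * (-x - y + z))
    (hB₁ : 0 ≤ T + 2 * (p + q + r)) (hB₂ : 0 ≤ T + 2 * (p - q - r))
    (hB₃ : 0 ≤ T + 2 * (-p + q - r)) (hB₄ : 0 ≤ T + 2 * (-p - q + r))
    (hC₁ : T + 2 * (p + q + r) ≤ 1) (hC₂ : T + 2 * (p - q - r) ≤ 1)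
    (hC₃ : T + 2 * (-p + q - r) ≤ 1) (hC₄ : T + 2 * (-p - q + r) ≤ 1) :
    T + 2 * (p * x + q * y + r * z) ≤ 9 / 8 := by
  obtain ⟨hx₁, hx₂⟩ := abs_le.1 hx
  obtain ⟨hy₁, hy₂⟩ := abs_le.1 hy
  obtain ⟨hz₁, hz₂⟩ := abs_le.1 hz
  rcases le_total 0 p with hp | hp <;> rcases le_total 0 q with hq | hq <;>
    rcases le_total 0 r with hr | hr
  · exact trace_add_pairing_le hp hq hr hC₁ hx₂ hy₂ hz₂
  · linarith [trace_sub_pairing_le (p := p) (q := q) (r := -r) (x := -x) (y := -y) (z := z)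
      (T := T) hp hq (by linarith) (by linarith) (by linarith) (by linarith) (by linarith)
      (by linarith) (by linarith) (by linarith) (by linarith)]
  · linarith [trace_sub_pairing_le (p := p) (q := -q) (r := r) (x := -x) (y := y) (z := -z)
      (T := T) hp (by linarith) hr (by linarith) (by linarith) (by linarith) (by linarith)
      (by linarith) (by linarith) (by linarith) (by linarith)]
  · linarith [trace_add_pairing_le (p := p) (q := -q) (r := -r) (x := x) (y := -y) (z := -z)
      (T := T) hp (by linarith) (by linarith) (by linarith) (by linarith) (by linarith)
      (by linarith)]
  · linarith [trace_sub_pairing_le (p := -p) (q := q) (r := r) (x := x) (y := -y) (z := -z)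
      (T := T) (by linarith) hq hr (by linarith) (by linarith) (by linarith) (by linarith)
      (by linarith) (by linarith) (by linarith) (by linarith)]
  · linarith [trace_add_pairing_le (p := -p) (q := q) (r := -r) (x := -x) (y := y) (z := -z)
      (T := T) (by linarith) hq (by linarith) (by linarith) (by linarith) (by linarith)
      (by linarith)]
  · linarith [trace_add_pairing_le (p := -p) (q := -q) (r := r) (x := -x) (y := -y) (z := z)
      (T := T) (by linarith) (by linarith) hr (by linarith) (by linarith) (by linarith)
      (by linarith)]
  · linarith [trace_sub_pairing_le (p := -p) (q := -q) (r := -r) (x := x) (y := y) (z := z)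
      (T := T) (by linarith) (by linarith) (by linarith) (by linarith) (by linarith)
      (by linarith) (by linarith) hA₁ hx₁ hy₁ hz₁]

/-- The quadratic form of a matrix is dominated by its norm as a map `ℓ∞ → ℓ₁`. -/
lemma dotProduct_mulVec_le_one {n : Type*} [Fintype n] {B : Matrix n n ℝ}
    (hB : ∀ x : n → ℝ, (∀ i, |x i| ≤ 1) → ∑ i, |B.mulVec x i| ≤ 1)
    {x : n → ℝ} (hx : ∀ i, |x i| ≤ 1) : x ⬝ᵥ B.mulVec x ≤ 1 := by
  refine le_trans (Finset.sum_le_sum fun i _ => ?_) (hB x hx)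
  calc x i * B.mulVec x i ≤ |x i * B.mulVec x i| := le_abs_self _
    _ = |x i| * |B.mulVec x i| := abs_mul _ _
    _ ≤ |B.mulVec x i| := mul_le_of_le_one_left (abs_nonneg _) (hx i)

/-- The quadratic form of a symmetric `3 × 3` matrix at a sign vector. -/
lemma dotProduct_mulVec_sign_vector {M : Matrix (Fin 3) (Fin 3) ℝ} (hM : M.IsHermitian)
    {s t u : ℝ} (hs : s ^ 2 = 1) (ht : t ^ 2 = 1) (hu : u ^ 2 = 1) :
    ![s, t, u] ⬝ᵥ M.mulVec ![s, t, u] = M 0 0 + M 1 1 + M 2 2 +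
      2 * (s * t * M 0 1 + s * u * M 0 2 + t * u * M 1 2) := by
  have h₁ : M 1 0 = M 0 1 := by simpa using hM.apply 0 1
  have h₂ : M 2 0 = M 0 2 := by simpa using hM.apply 0 2
  have h₃ : M 2 1 = M 1 2 := by simpa using hM.apply 1 2
  simp only [dotProduct, Matrix.mulVec, Fin.sum_univ_three, Matrix.cons_val, h₁, h₂, h₃]
  linear_combination M 0 0 * hs + M 1 1 * ht + M 2 2 * hu

/-- The pairing of positive contractions `A : ℓ₁³ → ℓ∞³` and `B : ℓ∞³ → ℓ₁³` is at most `9/8`. -/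
lemma sum_mul_le_of_posSemidef {A B : Matrix (Fin 3) (Fin 3) ℝ}
    (hA : A.PosSemidef) (hB : B.PosSemidef) (hA' : ∀ i j, |A i j| ≤ 1)
    (hB' : ∀ x : Fin 3 → ℝ, (∀ i, |x i| ≤ 1) → ∑ i, |B.mulVec x i| ≤ 1) :
    ∑ i, ∑ j, A i j * B i j ≤ 9 / 8 := by
  have key : ∀ {s t u : ℝ}, s ^ 2 = 1 → t ^ 2 = 1 → u ^ 2 = 1 →
      0 ≤ 3 + 2 * (s * t * A 0 1 + s * u * A 0 2 + t * u * A 1 2) ∧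
      0 ≤ B 0 0 + B 1 1 + B 2 2 + 2 * (s * t * B 0 1 + s * u * B 0 2 + t * u * B 1 2) ∧
      B 0 0 + B 1 1 + B 2 2 + 2 * (s * t * B 0 1 + s * u * B 0 2 + t * u * B 1 2) ≤ 1 := by
    intro s t u hs ht hu
    have h₁ := hA.dotProduct_mulVec_nonneg ![s, t, u]
    have h₂ := hB.dotProduct_mulVec_nonneg ![s, t, u]
    rw [star_trivial, dotProduct_mulVec_sign_vector hA.1 hs ht hu] at h₁
    rw [star_trivial, dotProduct_mulVec_sign_vector hB.1 hs ht hu] at h₂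
    refine ⟨?_, h₂, ?_⟩
    · linarith [(abs_le.1 (hA' 0 0)).2, (abs_le.1 (hA' 1 1)).2, (abs_le.1 (hA' 2 2)).2]
    · rw [← dotProduct_mulVec_sign_vector hB.1 hs ht hu]
      refine dotProduct_mulVec_le_one hB' fun i => ?_
      rw [← sq_le_one_iff_abs_le_one]
      fin_cases i
      exacts [hs.le, ht.le, hu.le]
  obtain ⟨a₁, b₁, c₁⟩ := key (s := 1) (t := 1) (u := 1) (by norm_num) (by norm_num) (by norm_num)
  obtain ⟨a₂, b₂, c₂⟩ := key (s := 1) (t := 1) (u := -1) (by norm_num) (by norm_num) (by norm_num)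
  obtain ⟨a₃, b₃, c₃⟩ := key (s := 1) (t := -1) (u := 1) (by norm_num) (by norm_num) (by norm_num)
  obtain ⟨a₄, b₄, c₄⟩ := key (s := -1) (t := 1) (u := 1) (by norm_num) (by norm_num) (by norm_num)
  have hoff := trace_add_pairing_le_of_sign_vectors (p := B 0 1) (q := B 0 2) (r := B 1 2)
    (T := B 0 0 + B 1 1 + B 2 2) (hA' 0 1) (hA' 0 2) (hA' 1 2)
    (by linarith) (by linarith) (by linarith) (by linarith) (by linarith) (by linarith)
    (by linarith) (by linarith) (by linarith) (by linarith) (by linarith) (by linarith)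
  have hdiag : ∀ i, A i i * B i i ≤ B i i := fun i =>
    mul_le_of_le_one_left hB.diag_nonneg (abs_le.1 (hA' i i)).2
  have hAs : ∀ i j, A i j = A j i := fun i j => by simpa using hA.1.apply j i
  have hBs : ∀ i j, B i j = B j i := fun i j => by simpa using hB.1.apply j i
  simp only [Fin.sum_univ_three]
  rw [hAs 1 0, hAs 2 0, hAs 2 1, hBs 1 0, hBs 2 0, hBs 2 1]
  linarith [hdiag 0, hdiag 1, hdiag 2]

/-- The matrix `c (3 I - J)`, with `J` the all-ones matrix, is positive semidefinite. -/
lemma posSemidef_three_smul_one_sub_ones {c : ℝ} (hc : 0 ≤ c) :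
    (!![2 * c, -c, -c; -c, 2 * c, -c; -c, -c, 2 * c] : Matrix (Fin 3) (Fin 3) ℝ).PosSemidef := by
  refine Matrix.PosSemidef.of_dotProduct_mulVec_nonneg ?_ fun x => ?_
  · ext i j
    fin_cases i <;> fin_cases j <;> simp
  · have h : 0 ≤ c * ((x 0 - x 1) ^ 2 + (x 0 - x 2) ^ 2 + (x 1 - x 2) ^ 2) := by positivity
    refine h.trans_eq ?_
    simp only [star_trivial, dotProduct, Matrix.mulVec, Fin.sum_univ_three, Matrix.of_apply,
      Matrix.cons_val]
    ring

/-- `γ(ℓ₁ℝ(3)) = 1.125`: the supremum of the Hilbert–Schmidt pairing `⟨A, B⟩` over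
positive semidefinite contractions `A : ℓ₁(3) → ℓ∞(3)` (i.e. `max |A i j| ≤ 1`) and
`B : ℓ∞(3) → ℓ₁(3)` (i.e. `‖Bx‖₁ ≤ 1` whenever `‖x‖∞ ≤ 1`) equals `9/8`. -/
theorem stmt_15 :
    sSup {c : ℝ | ∃ A B : Matrix (Fin 3) (Fin 3) ℝ,
      A.PosSemidef ∧ B.PosSemidef ∧
      (∀ i j, |A i j| ≤ 1) ∧
      (∀ x : Fin 3 → ℝ, (∀ i, |x i| ≤ 1) → ∑ i, |B.mulVec x i| ≤ 1) ∧
      c = ∑ i, ∑ j, A i j * B i j} = 9 / 8 := by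
  refine IsGreatest.csSup_eq ⟨⟨_, _,
    posSemidef_three_smul_one_sub_ones (c := 1 / 2) (by norm_num),
    posSemidef_three_smul_one_sub_ones (c := 1 / 8) (by norm_num), ?_, ?_, ?_⟩, ?_⟩
  · intro i j
    fin_cases i <;> fin_cases j <;> norm_num [abs_le]
  · intro x hx
    obtain ⟨h₀, h₀'⟩ := abs_le.1 (hx 0)
    obtain ⟨h₁, h₁'⟩ := abs_le.1 (hx 1)
    obtain ⟨h₂, h₂'⟩ := abs_le.1 (hx 2)
    simp only [Matrix.mulVec, dotProduct, Fin.sum_univ_three, Matrix.of_apply, Matrix.cons_val]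
    rcases abs_cases (2 * (1 / 8) * x 0 + -(1 / 8) * x 1 + -(1 / 8) * x 2) with h | h <;>
    rcases abs_cases (-(1 / 8) * x 0 + 2 * (1 / 8) * x 1 + -(1 / 8) * x 2) with h' | h' <;>
    rcases abs_cases (-(1 / 8) * x 0 + -(1 / 8) * x 1 + 2 * (1 / 8) * x 2) with h'' | h'' <;>
    linarith
  · simp only [Fin.sum_univ_three, Matrix.of_apply, Matrix.cons_val]
    norm_num
  · rintro c ⟨A, B, hA, hB, hA', hB', rfl⟩
    exact sum_mul_le_of_posSemidef hA hB hA' hB'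
end

section
/- (Carathéodory) Let φ be holomorphic on the open unit disc 𝔻 with |φ(z)| ≤ 1 for all z ∈ 𝔻. Then there exists a sequence (Bₖ) of finite Blaschke products, i.e., functions of the form B(z) = c · Π_{j=1}^N (z − a_j)/(1 − ā_j z) with |c| = 1, N ∈ ℕ, and a_1, …, a_N ∈ 𝔻, such that Bₖ → φ uniformly on every compact subset of 𝔻. -/
open Metric Polynomial ComplexConjugate

/-- The finite Blaschke product with unimodular factor `c` and zeros `a j`. -/
noncomputable def finiteBlaschke (c : ℂ) {N : ℕ} (a : Fin N → ℂ) (z : ℂ) : ℂ :=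
  c * ∏ j, (z - a j) / (1 - conj (a j) * z)

/-- The norm identity behind Möbius automorphisms of the disc. -/
theorem normSq_one_sub_conj_mul_sub (a z : ℂ) :
    ‖1 - conj a * z‖ ^ 2 - ‖z - a‖ ^ 2 = (1 - ‖a‖ ^ 2) * (1 - ‖z‖ ^ 2) := by
  simp only [← Complex.normSq_eq_norm_sq, Complex.normSq_apply, Complex.sub_re, Complex.sub_im,
    Complex.mul_re, Complex.mul_im, Complex.one_re, Complex.one_im, Complex.conj_re,
    Complex.conj_im]
  ring

theorem norm_sub_le_norm_one_sub_conj_mul {a z : ℂ} (ha : ‖a‖ ≤ 1) (hz : ‖z‖ ≤ 1) :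
    ‖z - a‖ ≤ ‖1 - conj a * z‖ := by
  have h := normSq_one_sub_conj_mul_sub a z
  have h₁ : 0 ≤ 1 - ‖a‖ ^ 2 := by nlinarith [norm_nonneg a]
  have h₂ : 0 ≤ 1 - ‖z‖ ^ 2 := by nlinarith [norm_nonneg z]
  exact (pow_le_pow_iff_left₀ (norm_nonneg _) (norm_nonneg _) two_ne_zero).1
    (by nlinarith [mul_nonneg h₁ h₂])

theorem norm_one_sub_conj_mul_le_norm_sub {a z : ℂ} (ha : ‖a‖ ≤ 1) (hz : 1 ≤ ‖z‖) :
    ‖1 - conj a * z‖ ≤ ‖z - a‖ := by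
  have h := normSq_one_sub_conj_mul_sub a z
  have h₁ : 0 ≤ 1 - ‖a‖ ^ 2 := by nlinarith [norm_nonneg a]
  have h₂ : 0 ≤ ‖z‖ ^ 2 - 1 := by nlinarith [norm_nonneg z]
  exact (pow_le_pow_iff_left₀ (norm_nonneg _) (norm_nonneg _) two_ne_zero).1
    (by nlinarith [mul_nonneg h₁ h₂])

theorem one_add_mul_ne_zero_of_norm_lt_one {a z : ℂ} (ha : ‖a‖ < 1) (hz : ‖z‖ ≤ 1) :
    1 + a * z ≠ 0 := by
  intro h
  have h₁ : ‖a * z‖ = 1 := by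
    rw [show a * z = -1 by linear_combination h]; simp
  rw [norm_mul] at h₁
  nlinarith [norm_nonneg a, norm_nonneg z]

theorem one_sub_conj_mul_ne_zero {a z : ℂ} (ha : ‖a‖ < 1) (hz : ‖z‖ ≤ 1) :
    1 - conj a * z ≠ 0 := by
  have := one_add_mul_ne_zero_of_norm_lt_one (a := -conj a) (by simpa using ha) hz
  rwa [neg_mul, ← sub_eq_add_neg] at this

theorem norm_finiteBlaschke_le_one {c : ℂ} (hc : ‖c‖ = 1) {N : ℕ} {a : Fin N → ℂ}
    (ha : ∀ j, ‖a j‖ < 1) {z : ℂ} (hz : ‖z‖ ≤ 1) : ‖finiteBlaschke c a z‖ ≤ 1 := by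
  rw [finiteBlaschke, norm_mul, hc, one_mul, norm_prod]
  refine Finset.prod_le_one (fun _ _ => norm_nonneg _) fun j _ => ?_
  rw [norm_div]
  exact div_le_one_of_le₀ (norm_sub_le_norm_one_sub_conj_mul (ha j).le hz) (norm_nonneg _)

theorem exists_fin_eval_eq_prod_of_monic {p : ℂ[X]} (hp : p.Monic) {n : ℕ}
    (hn : p.natDegree = n) : ∃ r : Fin n → ℂ, ∀ z, p.eval z = ∏ j, (z - r j) := by
  have hs := IsAlgClosed.splits p
  have hl : p.roots.toList.length = n := by
    rw [Multiset.length_toList, ← hn, hs.natDegree_eq_card_roots]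
  subst hl
  refine ⟨fun j => p.roots.toList[j], fun z => ?_⟩
  rw [hs.eval_eq_prod_roots_of_monic hp, ← List.prod_ofFn]
  conv_lhs => rw [← Multiset.coe_toList p.roots]
  rw [Multiset.map_coe, Multiset.prod_coe]
  congr 1
  apply List.ext_getElem <;> simp

theorem prod_one_sub_conj_mul {N : ℕ} (a : Fin N → ℂ) {z : ℂ} (hz : z ≠ 0) :
    ∏ j, (1 - conj (a j) * z) = z ^ N * conj (∏ j, ((conj z)⁻¹ - a j)) := by
  rw [map_prod, ← Fin.prod_const, ← Finset.prod_mul_distrib]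
  refine Finset.prod_congr rfl fun j _ => ?_
  simp only [map_sub, map_inv₀, Complex.conj_conj]
  field_simp

theorem prod_sub_eq_pow_mul_conj {N : ℕ} (a : Fin N → ℂ) {z : ℂ} (hz : z ≠ 0) :
    ∏ j, (z - a j) = z ^ N * conj (∏ j, (1 - conj (a j) * (conj z)⁻¹)) := by
  rw [map_prod, ← Fin.prod_const, ← Finset.prod_mul_distrib]
  refine Finset.prod_congr rfl fun j _ => ?_
  simp only [map_sub, map_mul, map_one, map_inv₀, Complex.conj_conj]
  field_simp

/-- A monic polynomial form of the numerator of a Möbius transform of `z * B z`. -/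
theorem exists_fin_prod_sub_eq {N : ℕ} (a : Fin N → ℂ) (β : ℂ) :
    ∃ r : Fin (N + 1) → ℂ, ∀ z,
      ∏ j, (z - r j) = z * ∏ j, (z - a j) + β * ∏ j, (1 - conj (a j) * z) := by
  set P : ℂ[X] := X * ∏ j, (X - C (a j)) with hP
  set Q : ℂ[X] := C β * ∏ j, (1 - C (conj (a j)) * X) with hQ
  have hm : (∏ j, (X - C (a j))).Monic := monic_prod_of_monic _ _ fun j _ => monic_X_sub_C _
  have hPm : P.Monic := monic_X.mul hm
  have hPd : P.natDegree = N + 1 := by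
    rw [hP, monic_X.natDegree_mul hm, natDegree_X, natDegree_prod_of_monic _ _
      fun j _ => monic_X_sub_C _]
    simp [add_comm]
  have hQd : Q.natDegree ≤ N := by
    refine (natDegree_C_mul_le _ _).trans ((natDegree_prod_le _ _).trans ?_)
    refine (Finset.sum_le_card_nsmul _ _ 1 fun j _ => ?_).trans (by simp)
    compute_degree
  have hlt : Q.degree < P.degree := degree_lt_degree (by omega)
  obtain ⟨r, hr⟩ := exists_fin_eval_eq_prod_of_monic (hPm.add_of_left hlt)
    ((natDegree_add_eq_left_of_degree_lt hlt).trans hPd)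
  exact ⟨r, fun z => by rw [← hr z]; simp [hP, hQ, eval_prod]⟩

/-- Finite Blaschke products are closed under `B ↦ (z B + α) / (1 + conj α z B)`. -/
theorem exists_finiteBlaschke_eq_moebius {c : ℂ} (hc : ‖c‖ = 1) {N : ℕ} {a : Fin N → ℂ}
    (ha : ∀ j, ‖a j‖ < 1) {α : ℂ} (hα : ‖α‖ < 1) :
    ∃ r : Fin (N + 1) → ℂ, (∀ j, ‖r j‖ < 1) ∧ ∀ z : ℂ, ‖z‖ < 1 →
      finiteBlaschke c r z =
        (z * finiteBlaschke c a z + α) / (1 + conj α * (z * finiteBlaschke c a z)) := by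
  have hcc : c * conj c = 1 := by rw [Complex.mul_conj']; simp [hc]
  obtain ⟨r, hr⟩ := exists_fin_prod_sub_eq a (α * conj c)
  have hstar : ∀ z, ∏ j, (1 - conj (r j) * z) =
      ∏ j, (1 - conj (a j) * z) + conj α * c * (z * ∏ j, (z - a j)) := by
    intro z
    rcases eq_or_ne z 0 with rfl | hz
    · simp
    rw [prod_one_sub_conj_mul r hz, hr, prod_one_sub_conj_mul a hz, prod_sub_eq_pow_mul_conj a hz]
    simp only [map_add, map_mul, map_inv₀, Complex.conj_conj]
    field_simp
    ring
  refine ⟨r, fun k => ?_, fun z hz => ?_⟩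
  · by_contra! hk
    have h0 := hr (r k)
    rw [Finset.prod_eq_zero (Finset.mem_univ k) (sub_self _)] at h0
    set p := ∏ j, (r k - a j) with hp
    set q := ∏ j, (1 - conj (a j) * r k) with hq
    have hqp : ‖q‖ ≤ ‖p‖ := by
      rw [hp, hq, norm_prod, norm_prod]
      exact Finset.prod_le_prod (fun _ _ => norm_nonneg _)
        fun j _ => norm_one_sub_conj_mul_le_norm_sub (ha j).le hk
    have hp0 : 0 < ‖p‖ := norm_pos_iff.2 <| Finset.prod_ne_zero_iff.2 fun j _ h => by
      have := ha j
      rw [← sub_eq_zero.1 h] at this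
      linarith
    have hnorm : ‖r k‖ * ‖p‖ = ‖α‖ * ‖q‖ := by
      have : r k * p = -(α * conj c * q) := by linear_combination -h0
      simpa [hc] using congrArg norm this
    nlinarith [norm_nonneg α, norm_nonneg q, mul_le_mul_of_nonneg_left hqp (norm_nonneg α)]
  · have hB := norm_finiteBlaschke_le_one hc ha hz.le
    have hden : 1 + conj α * (z * finiteBlaschke c a z) ≠ 0 :=
      one_add_mul_ne_zero_of_norm_lt_one (by simpa using hα) <| by
        rw [norm_mul]; exact mul_le_one₀ hz.le (norm_nonneg _) hB
    have hq : ∏ j, (1 - conj (a j) * z) ≠ 0 :=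
      Finset.prod_ne_zero_iff.2 fun j _ => one_sub_conj_mul_ne_zero (ha j) hz.le
    simp only [finiteBlaschke, Finset.prod_div_distrib] at hden ⊢
    rw [hr, hstar]
    generalize ∏ j, (1 - conj (a j) * z) = q at *
    generalize ∏ j, (z - a j) = p at *
    have hden' : q + conj α * c * (z * p) ≠ 0 := by
      intro h
      apply hden
      field_simp
      linear_combination h
    rw [mul_div_assoc', div_eq_div_iff hden' hden]
    field_simp
    linear_combination (α * q * (q + conj α * z * c * p)) * hcc

theorem norm_one_sub_mul_one_add_sq_le {w : ℂ} (hw : ‖w‖ ≤ 1) {t : ℝ} (ht₀ : 0 ≤ t)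
    (ht₁ : t ≤ 1) : ‖1 - w‖ * (1 + t) ≤ 2 * ‖1 - t * w‖ := by
  refine (pow_le_pow_iff_left₀ (by positivity) (by positivity) two_ne_zero).1 ?_
  have hS : w.re ^ 2 + w.im ^ 2 ≤ 1 := by
    have := Complex.normSq_eq_norm_sq w
    rw [Complex.normSq_apply] at this
    nlinarith [norm_nonneg w]
  rw [mul_pow, mul_pow, ← Complex.normSq_eq_norm_sq, ← Complex.normSq_eq_norm_sq,
    Complex.normSq_apply, Complex.normSq_apply]
  simp only [Complex.sub_re, Complex.sub_im, Complex.mul_re, Complex.mul_im, Complex.one_re,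
    Complex.one_im, Complex.ofReal_re, Complex.ofReal_im]
  have h₁ : 0 ≤ (1 - t) ^ 2 * ((1 + w.re) ^ 2 + w.im ^ 2) := by positivity
  have h₂ : 0 ≤ (1 - t ^ 2) * (1 - (w.re ^ 2 + w.im ^ 2)) :=
    mul_nonneg (by nlinarith) (by linarith)
  nlinarith

/-- Multiplication by `z` contracts the pseudo-hyperbolic distance by `2‖z‖ / (1 + ‖z‖²)`. -/
theorem norm_mul_sub_mul_le {z u v : ℂ} (hz : ‖z‖ ≤ 1) (hu : ‖u‖ ≤ 1) (hv : ‖v‖ ≤ 1)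
    {ε : ℝ} (hε : 0 ≤ ε) (h : ‖u - v‖ ≤ ε * ‖1 - conj v * u‖) :
    ‖z * u - z * v‖ ≤ ε * (2 * ‖z‖ / (1 + ‖z‖ ^ 2)) * ‖1 - conj (z * v) * (z * u)‖ := by
  have hw : ‖conj v * u‖ ≤ 1 := by
    rw [norm_mul, Complex.norm_conj]; exact mul_le_one₀ hv (norm_nonneg _) hu
  have key := norm_one_sub_mul_one_add_sq_le hw (sq_nonneg ‖z‖)
    (pow_le_one₀ (norm_nonneg z) hz)
  have heq : conj (z * v) * (z * u) = ((‖z‖ ^ 2 : ℝ) : ℂ) * (conj v * u) := by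
    push_cast
    rw [← Complex.conj_mul', map_mul]; ring
  rw [heq, ← mul_sub, norm_mul]
  have hpos : 0 < 1 + ‖z‖ ^ 2 := by positivity
  set m := ‖1 - ((‖z‖ ^ 2 : ℝ) : ℂ) * (conj v * u)‖
  calc ‖z‖ * ‖u - v‖ ≤ ‖z‖ * (ε * ‖1 - conj v * u‖) := by gcongr
    _ ≤ ‖z‖ * (ε * (2 * m / (1 + ‖z‖ ^ 2))) := by
      gcongr
      rwa [le_div_iff₀ hpos]
    _ = _ := by ring

/-- Möbius automorphisms of the disc do not increase the pseudo-hyperbolic distance. -/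
theorem norm_moebius_sub_moebius_le {α u v : ℂ} (hu : 1 + conj α * u ≠ 0)
    (hv : 1 + conj α * v ≠ 0) {ε : ℝ} (h : ‖u - v‖ ≤ ε * ‖1 - conj v * u‖) :
    ‖(u + α) / (1 + conj α * u) - (v + α) / (1 + conj α * v)‖ ≤
      ε * ‖1 - conj ((v + α) / (1 + conj α * v)) * ((u + α) / (1 + conj α * u))‖ := by
  have hv' : 1 + α * conj v ≠ 0 := by
    intro h0; apply hv; simpa using congrArg conj h0
  have e₁ : (u + α) / (1 + conj α * u) - (v + α) / (1 + conj α * v) =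
      (1 - conj α * α) * (u - v) / ((1 + conj α * u) * (1 + conj α * v)) := by
    rw [div_sub_div _ _ hu hv]; congr 1; ring
  have e₂ : 1 - conj ((v + α) / (1 + conj α * v)) * ((u + α) / (1 + conj α * u)) =
      (1 - conj α * α) * (1 - conj v * u) / ((1 + conj α * u) * conj (1 + conj α * v)) := by
    simp only [map_div₀, map_add, map_mul, map_one, Complex.conj_conj]
    rw [div_mul_div_comm, eq_div_iff (mul_ne_zero hu hv'), sub_mul, mul_comm (1 + α * conj v),
      div_mul_cancel₀ _ (mul_ne_zero hu hv')]
    ring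
  rw [e₁, e₂]
  simp only [norm_div, norm_mul, Complex.norm_conj]
  rw [← mul_div_assoc, mul_left_comm ε]
  gcongr

/-- One step of the Schur algorithm. -/
theorem exists_schur_parameter {φ : ℂ → ℂ} (hφ : DifferentiableOn ℂ φ (ball 0 1))
    (hb : ∀ z ∈ ball (0 : ℂ) 1, ‖φ z‖ ≤ 1) (h0 : ‖φ 0‖ < 1) :
    ∃ ψ : ℂ → ℂ, DifferentiableOn ℂ ψ (ball 0 1) ∧ (∀ z ∈ ball (0 : ℂ) 1, ‖ψ z‖ ≤ 1) ∧
      ∀ z ∈ ball (0 : ℂ) 1, φ z = (z * ψ z + φ 0) / (1 + conj (φ 0) * (z * ψ z)) := by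
  set α := φ 0 with hα
  set g : ℂ → ℂ := fun z => (φ z - α) / (1 - conj α * φ z) with hg
  have hden : ∀ z ∈ ball (0 : ℂ) 1, 1 - conj α * φ z ≠ 0 := fun z hz =>
    one_sub_conj_mul_ne_zero h0 (hb z hz)
  have hgd : DifferentiableOn ℂ g (ball 0 1) :=
    (hφ.sub_const α).div ((hφ.const_mul _).const_sub 1) hden
  have hg0 : g 0 = 0 := by simp [hg, hα]
  have hgm : Set.MapsTo g (ball 0 1) (closedBall (g 0) 1) := fun z hz => by
    rw [hg0, mem_closedBall_zero_iff, hg, norm_div]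
    exact div_le_one_of_le₀ (norm_sub_le_norm_one_sub_conj_mul h0.le (hb z hz)) (norm_nonneg _)
  have hψ : ∀ z, z * dslope g 0 z = g z := fun z => by
    simpa [hg0] using sub_smul_dslope g 0 z
  have hψb : ∀ z ∈ ball (0 : ℂ) 1, ‖dslope g 0 z‖ ≤ 1 := fun z hz => by
    simpa using Complex.norm_dslope_le_div_of_mapsTo_ball hgd hgm hz
  refine ⟨dslope g 0, (Complex.differentiableOn_dslope (ball_mem_nhds 0 one_pos)).2 hgd, hψb,
    fun z hz => ?_⟩
  have hne : 1 + conj α * g z ≠ 0 := by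
    refine one_add_mul_ne_zero_of_norm_lt_one (by simpa using h0) ?_
    simpa [hg0] using hgm hz
  rw [hψ, eq_div_iff hne]
  have hgz : g z * (1 - conj α * φ z) = φ z - α := div_mul_cancel₀ _ (hden z hz)
  linear_combination -hgz

theorem exists_finiteBlaschke_norm_sub_le (n : ℕ) {φ : ℂ → ℂ}
    (hφ : DifferentiableOn ℂ φ (ball 0 1)) (hb : ∀ z ∈ ball (0 : ℂ) 1, ‖φ z‖ ≤ 1) :
    ∃ (c : ℂ) (N : ℕ) (a : Fin N → ℂ), ‖c‖ = 1 ∧ (∀ j, ‖a j‖ < 1) ∧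
      ∀ z ∈ ball (0 : ℂ) 1, ‖φ z - finiteBlaschke c a z‖ ≤
        (2 * ‖z‖ / (1 + ‖z‖ ^ 2)) ^ n * ‖1 - conj (finiteBlaschke c a z) * φ z‖ := by
  induction n generalizing φ with
  | zero =>
    refine ⟨1, 0, Fin.elim0, by simp, fun j => j.elim0, fun z _ => ?_⟩
    simp [finiteBlaschke, norm_sub_rev]
  | succ n ih =>
    have h0mem : (0 : ℂ) ∈ ball (0 : ℂ) 1 := mem_ball_self one_pos
    rcases (hb 0 h0mem).lt_or_eq with h0 | h0
    · obtain ⟨ψ, hψd, hψb, hψ⟩ := exists_schur_parameter hφ hb h0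
      obtain ⟨c, N, a, hc, ha, hB⟩ := ih hψd hψb
      obtain ⟨r, hr, hrB⟩ := exists_finiteBlaschke_eq_moebius hc ha h0
      refine ⟨c, N + 1, r, hc, hr, fun z hz => ?_⟩
      have hz1 : ‖z‖ < 1 := mem_ball_zero_iff.1 hz
      have hBz := norm_finiteBlaschke_le_one hc ha hz1.le
      have hne : ∀ w : ℂ, ‖w‖ ≤ 1 → 1 + conj (φ 0) * (z * w) ≠ 0 := fun w hw =>
        one_add_mul_ne_zero_of_norm_lt_one (by simpa using h0) <| by
          rw [norm_mul]; exact mul_le_one₀ hz1.le (norm_nonneg _) hw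
      rw [hrB z hz1, hψ z hz, pow_succ]
      exact norm_moebius_sub_moebius_le (hne _ (hψb z hz)) (hne _ hBz)
        (norm_mul_sub_mul_le hz1.le (hψb z hz) hBz (by positivity) (hB z hz))
    · refine ⟨φ 0, 0, Fin.elim0, h0, fun j => j.elim0, fun z hz => ?_⟩
      have hconst : φ z = φ 0 := Complex.eqOn_of_isPreconnected_of_isMaxOn_norm
        (convex_ball (0 : ℂ) 1).isPreconnected isOpen_ball hφ h0mem
        (fun w hw => by simpa [h0] using hb w hw) hz
      rw [show φ z - finiteBlaschke (φ 0) Fin.elim0 z = 0 by simp [finiteBlaschke, hconst],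
        norm_zero]
      positivity

/-- The contraction factor `2x / (1 + x²)` is monotone on `[0, 1]`. -/
theorem two_mul_div_one_add_sq_le {x y : ℝ} (hx : 0 ≤ x) (hxy : x ≤ y) (hy : y ≤ 1) :
    2 * x / (1 + x ^ 2) ≤ 2 * y / (1 + y ^ 2) := by
  rw [div_le_div_iff₀ (by positivity) (by positivity)]
  nlinarith [mul_nonneg (sub_nonneg.2 hxy) (sub_nonneg.2 (mul_le_one₀ (hxy.trans hy)
    (hx.trans hxy) hy))]

/-- Carathéodory's theorem: every holomorphic `φ : 𝔻 → closure 𝔻` is the limit, uniformly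
on compact subsets of `𝔻`, of a sequence of finite Blaschke products. -/
theorem stmt_16 (φ : ℂ → ℂ) (hφ : DifferentiableOn ℂ φ (Metric.ball 0 1))
    (hbound : ∀ z ∈ Metric.ball (0 : ℂ) 1, ‖φ z‖ ≤ 1) :
    ∃ B : ℕ → ℂ → ℂ,
      (∀ k : ℕ, ∃ (c : ℂ) (N : ℕ) (a : Fin N → ℂ), ‖c‖ = 1 ∧ (∀ j, ‖a j‖ < 1) ∧
        ∀ z : ℂ, B k z = c * ∏ j, (z - a j) / (1 - (starRingEnd ℂ) (a j) * z)) ∧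
      ∀ K : Set ℂ, K ⊆ Metric.ball 0 1 → IsCompact K →
        TendstoUniformlyOn (fun k z => B k z) φ Filter.atTop K := by
  choose c N a hc ha hB using fun n : ℕ => exists_finiteBlaschke_norm_sub_le n hφ hbound
  refine ⟨fun k => finiteBlaschke (c k) (a k), fun k => ⟨c k, N k, a k, hc k, ha k, fun z => rfl⟩,
    fun K hK hKc => ?_⟩
  obtain ⟨r, hr, hKr⟩ : ∃ r ∈ Set.Ico (0 : ℝ) 1, ∀ z ∈ K, ‖z‖ ≤ r := by
    rcases K.eq_empty_or_nonempty with rfl | hne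
    · exact ⟨0, by simp, by simp⟩
    · obtain ⟨w, hw, hmax⟩ := hKc.exists_isMaxOn hne continuous_norm.continuousOn
      exact ⟨‖w‖, ⟨norm_nonneg w, mem_ball_zero_iff.1 (hK hw)⟩, fun z hz => hmax hz⟩
  obtain ⟨hr0, hr1⟩ := hr
  have hq1 : 2 * r / (1 + r ^ 2) < 1 := by
    rw [div_lt_one (by positivity)]
    nlinarith [sq_pos_of_pos (sub_pos.2 hr1)]
  have hlim : Filter.Tendsto (fun k : ℕ => (2 * r / (1 + r ^ 2)) ^ k * 2) Filter.atTop (nhds 0) := by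
    simpa using (tendsto_pow_atTop_nhds_zero_of_lt_one (by positivity) hq1).mul_const 2
  rw [Metric.tendstoUniformlyOn_iff]
  intro ε hε
  filter_upwards [hlim.eventually (gt_mem_nhds hε)] with k hk z hz
  have hz1 : ‖z‖ < 1 := mem_ball_zero_iff.1 (hK hz)
  rw [dist_eq_norm]
  refine lt_of_le_of_lt ((hB k z (hK hz)).trans ?_) hk
  have hprod : ‖conj (finiteBlaschke (c k) (a k) z) * φ z‖ ≤ 1 := by
    rw [norm_mul, Complex.norm_conj]
    exact mul_le_one₀ (norm_finiteBlaschke_le_one (hc k) (ha k) hz1.le) (norm_nonneg _)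
      (hbound z (hK hz))
  have htwo : ‖1 - conj (finiteBlaschke (c k) (a k) z) * φ z‖ ≤ 2 := by
    refine (norm_sub_le _ _).trans ?_
    rw [norm_one]; linarith
  gcongr ?_ ^ k * ?_
  exact two_mul_div_one_add_sq_le (norm_nonneg z) (hKr z hz) hr1.le
end

section
/- Let G be a Gurariy space: a separable Banach space such that for every ε > 0, every pair of finite-dimensional normed spaces E ⊆ F, and every linear isometry T : E → G, there exists a linear map T̂ : F → G extending T with (1+ε)^{-1}‖x‖ ≤ ‖T̂x‖ ≤ (1+ε)‖x‖ for all x ∈ F. If a Banach space X is almost isometric to G, meaning that for every ε > 0 there exists a linear isomorphism S : X → G with ‖S‖ · ‖S^{-1}‖ ≤ 1 + ε, then X is itself a Gurariy space. -/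
/-- `G` is a Gurariy space: a separable Banach space such that for every `ε > 0`, every
pair of finite-dimensional normed spaces `E ⊆ F` and every linear isometry `T : E → G`,
there is a linear extension `T̂ : F → G` with
`(1+ε)⁻¹ ‖x‖ ≤ ‖T̂ x‖ ≤ (1+ε) ‖x‖` for all `x ∈ F`. -/
def IsGurariySpace (G : Type*) [NormedAddCommGroup G] [NormedSpace ℝ G] : Prop :=
  TopologicalSpace.SeparableSpace G ∧ CompleteSpace G ∧
  ∀ ε : ℝ, 0 < ε →
    ∀ (F : Type) [NormedAddCommGroup F] [NormedSpace ℝ F] [FiniteDimensional ℝ F],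
      ∀ (E : Submodule ℝ F) (T : ↥E →ₗ[ℝ] G),
      (∀ x : ↥E, ‖T x‖ = ‖x‖) →
      ∃ S : F →ₗ[ℝ] G, (∀ x : ↥E, S ↑x = T x) ∧
        ∀ x : F, (1 + ε)⁻¹ * ‖x‖ ≤ ‖S x‖ ∧ ‖S x‖ ≤ (1 + ε) * ‖x‖

/-- A seminorm `p` on a subspace which is dominated by a seminorm `q` on the whole space extends
to a seminorm which is the largest among those dominated by `q` everywhere and by `p` on the
subspace. -/
theorem Seminorm.exists_maximal_extension {F : Type*} [AddCommGroup F] [Module ℝ F]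
    (E : Submodule ℝ F) (p : Seminorm ℝ E) (q : Seminorm ℝ F) (hpq : ∀ e : E, p e ≤ q e) :
    ∃ N : Seminorm ℝ F, (∀ e : E, N e = p e) ∧ (∀ x, N x ≤ q x) ∧
      ∀ r : Seminorm ℝ F, (∀ x, r x ≤ q x) → (∀ e : E, r e ≤ p e) → ∀ x, r x ≤ N x := by
  have bdd (x : F) : BddBelow (Set.range fun e : E => p e + q (x - e)) :=
    ⟨0, by rintro _ ⟨e, rfl⟩; positivity⟩
  have iInf_le (x : F) (e : E) : (⨅ e : E, p e + q (x - e)) ≤ p e + q (x - e) :=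
    ciInf_le (bdd x) e
  refine ⟨Seminorm.ofSMulLE (fun x => ⨅ e : E, p e + q (x - e)) ?_ ?_ ?_, ?_, ?_, ?_⟩
  · refine le_antisymm ?_ (le_ciInf fun e => by positivity)
    simpa using iInf_le 0 0
  · refine fun x y => le_ciInf_add_ciInf fun e f => (iInf_le (x + y) (e + f)).trans ?_
    have hp := map_add_le_add p e f
    have hq := map_add_le_add q (x - e) (y - f)
    rw [sub_add_sub_comm] at hq
    push_cast
    linarith
  · intro c x
    rw [Real.mul_iInf_of_nonneg (norm_nonneg c)]
    refine le_ciInf fun e => (iInf_le (c • x) (c • e)).trans_eq ?_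
    rw [Submodule.coe_smul, ← smul_sub, map_smul_eq_mul, map_smul_eq_mul, mul_add]
  · refine fun e => le_antisymm ((iInf_le e e).trans_eq (by simp)) (le_ciInf fun f => ?_)
    have hp := map_add_le_add p f (e - f)
    have hq := hpq (e - f)
    rw [add_sub_cancel] at hp
    push_cast at hq
    linarith
  · exact fun x => (iInf_le x 0).trans_eq (by simp)
  · refine fun r hq hp x => le_ciInf fun e => ?_
    have hr := map_add_le_add r (e : F) (x - e)
    rw [add_sub_cancel] at hr
    linarith [hp e, hq (x - e)]

/-- The extension property of a Gurariy space, for a norm given as a seminorm with trivial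
kernel. -/
theorem IsGurariySpace.exists_extension {G : Type*} [NormedAddCommGroup G] [NormedSpace ℝ G]
    (hG : IsGurariySpace G) {ε : ℝ} (hε : 0 < ε) {F : Type} [AddCommGroup F] [Module ℝ F]
    [FiniteDimensional ℝ F] (N : Seminorm ℝ F) (hN : ∀ x, N x = 0 → x = 0)
    (E : Submodule ℝ F) (T : E →ₗ[ℝ] G) (hT : ∀ x : E, ‖T x‖ = N x) :
    ∃ S : F →ₗ[ℝ] G, (∀ x : E, S x = T x) ∧
      ∀ x : F, (1 + ε)⁻¹ * N x ≤ ‖S x‖ ∧ ‖S x‖ ≤ (1 + ε) * N x := by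
  let : Norm F := ⟨N⟩
  have core : NormedSpace.Core ℝ F :=
    { norm_nonneg := apply_nonneg N
      norm_smul := map_smul_eq_mul N
      norm_triangle := map_add_le_add N
      norm_eq_zero_iff := fun x => ⟨hN x, fun h => h ▸ map_zero N⟩ }
  let : NormedAddCommGroup F := NormedAddCommGroup.ofCore core
  let : NormedSpace ℝ F := NormedSpace.ofCore core
  exact hG.2.2 ε hε F E T hT

/-- Positive bounds for an isomorphism and its inverse, valid also between trivial spaces. -/
theorem ContinuousLinearEquiv.exists_pos_bounds {G X : Type*} [NormedAddCommGroup G]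
    [NormedSpace ℝ G] [NormedAddCommGroup X] [NormedSpace ℝ X] (S : X ≃L[ℝ] G) {C : ℝ}
    (hC : 1 ≤ C) (hS : ‖(S : X →L[ℝ] G)‖ * ‖(S.symm : G →L[ℝ] X)‖ ≤ C) :
    ∃ b c : ℝ, 0 < b ∧ 0 < c ∧ 1 ≤ b * c ∧ b * c ≤ C ∧ (∀ x, ‖S x‖ ≤ b * ‖x‖) ∧
      ∀ y, ‖S.symm y‖ ≤ c * ‖y‖ := by
  cases subsingleton_or_nontrivial X with
  | inl _ =>
    refine ⟨1, 1, one_pos, one_pos, by simp, by simpa using hC, fun x => ?_, fun y => ?_⟩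
    · simp [Subsingleton.elim x 0]
    · simp [Subsingleton.elim (S.symm y) 0]
  | inr _ =>
    exact ⟨_, _, S.norm_pos, S.norm_symm_pos, S.one_le_norm_mul_norm_symm, hS, (S : X →L[ℝ] G).le_opNorm,
      (S.symm : G →L[ℝ] X).le_opNorm⟩

/-- A Banach space almost isometric to a Gurariy space is itself a Gurariy space. -/
theorem stmt_18 {G X : Type*} [NormedAddCommGroup G] [NormedSpace ℝ G]
    [NormedAddCommGroup X] [NormedSpace ℝ X]
    (hG : IsGurariySpace G)
    (hai : ∀ ε : ℝ, 0 < ε → ∃ S : X ≃L[ℝ] G,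
      ‖(S : X →L[ℝ] G)‖ * ‖(S.symm : G →L[ℝ] X)‖ ≤ 1 + ε) :
    IsGurariySpace X := by
  obtain ⟨S₀, -⟩ := hai 1 one_pos
  have := hG.1
  have := hG.2.1
  refine ⟨S₀.symm.surjective.denseRange.separableSpace S₀.symm.continuous,
    (completeSpace_congr (e := S₀.toEquiv) S₀.isUniformEmbedding).2 this, ?_⟩
  intro ε hε F _ _ _ E T hT
  obtain ⟨δ, hδ, hδε⟩ : ∃ δ : ℝ, 0 < δ ∧ (1 + δ) * (1 + δ) ≤ 1 + ε := by
    refine ⟨min 1 (ε / 3), by positivity, ?_⟩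
    have h₀ : 0 < min 1 (ε / 3) := by positivity
    nlinarith [min_le_left 1 (ε / 3), min_le_right 1 (ε / 3)]
  obtain ⟨S, hS⟩ := hai δ hδ
  obtain ⟨b, c, hb, hc, hbc₁, hbc, hSb, hSc⟩ := S.exists_pos_bounds (by linarith) hS
  let U : E →ₗ[ℝ] G := (S : X →ₗ[ℝ] G) ∘ₗ T
  have hU (e : E) : S.symm (U e) = T e := S.symm_apply_apply (T e)
  obtain ⟨N, hNE, hNle, hNmax⟩ := Seminorm.exists_maximal_extension E
    ((normSeminorm ℝ G).comp U) (b.toNNReal • normSeminorm ℝ F) fun e => by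
      simpa [NNReal.smul_def, hb.le, hT, U] using hSb (T e)
  have hNb (x : F) : N x ≤ b * ‖x‖ := by
    simpa [NNReal.smul_def, hb.le] using hNle x
  have hNc (x : F) : ‖x‖ ≤ c * N x := by
    have hr := hNmax (c⁻¹.toNNReal • normSeminorm ℝ F)
    simp only [smul_apply, NNReal.smul_def, coe_normSeminorm, smul_eq_mul,
      Real.coe_toNNReal _ hb.le, Real.coe_toNNReal _ (inv_pos.2 hc).le, Seminorm.comp_apply] at hr
    refine (inv_mul_le_iff₀ hc).1 (hr (fun x => ?_) (fun e => ?_) x)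
    · gcongr
      exact (inv_le_iff_one_le_mul₀ hc).2 hbc₁
    · rw [inv_mul_le_iff₀ hc, Submodule.norm_coe, ← hT, ← hU]
      exact hSc (U e)
  obtain ⟨V, hVE, hV⟩ := hG.exists_extension hδ N
    (fun x hx => norm_le_zero_iff.1 (by simpa [hx] using hNc x)) E U fun e => (hNE e).symm
  refine ⟨(S.symm : G →ₗ[ℝ] X) ∘ₗ V, fun e => ?_, fun x => ⟨?_, ?_⟩⟩
  · simpa [hVE] using hU e
  · change _ ≤ ‖S.symm (V x)‖
    have hVS : ‖V x‖ ≤ b * ‖S.symm (V x)‖ := by simpa using hSb (S.symm (V x))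
    rw [inv_mul_le_iff₀ (by positivity)]
    calc ‖x‖ ≤ c * N x := hNc x
      _ ≤ c * ((1 + δ) * (b * ‖S.symm (V x)‖)) := by
        gcongr
        exact ((inv_mul_le_iff₀ (by positivity)).1 (hV x).1).trans (by gcongr)
      _ = (b * c) * (1 + δ) * ‖S.symm (V x)‖ := by ring
      _ ≤ (1 + δ) * (1 + δ) * ‖S.symm (V x)‖ := by gcongr
      _ ≤ (1 + ε) * ‖S.symm (V x)‖ := by gcongr
  · calc ‖S.symm (V x)‖ ≤ c * ‖V x‖ := hSc (V x)
      _ ≤ c * ((1 + δ) * (b * ‖x‖)) := by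
        gcongr
        exact (hV x).2.trans (by gcongr; exact hNb x)
      _ = (b * c) * (1 + δ) * ‖x‖ := by ring
      _ ≤ (1 + δ) * (1 + δ) * ‖x‖ := by gcongr
      _ ≤ (1 + ε) * ‖x‖ := by gcongr
end
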